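/- arXiv:2310.05240 — 11 statements merged into one kernel-verified Lean document; each statement's English description precedes it below -/
import Mathlib

section
/- Let q be a prime, m < d positive integers, and let R ∈ F_q^{d×m} be a uniformly random matrix. Then for every fixed matrix Σ ∈ F_q^{m×n} whose columns are pairwise distinct, with probability at least 1 − q^{−(d−m)} the columns of RΣ are pairwise distinct. -/
open scoped ENNReal

/-- At most a fraction `|K|⁻ᵈ` of the matrices with `d` rows over `K` kill a given nonzero
vector. -/
theorem Matrix.card_mulVec_eq_zero_mul_card_le {K ι κ : Type*} [Field K] [Finite K]
    [Finite ι] [Fintype κ] {v : κ → K} (hv : v ≠ 0) :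
    Nat.card {R : Matrix ι κ K | R.mulVec v = 0} * Nat.card (ι → K) ≤
      Nat.card (Matrix ι κ K) := by
  classical
  obtain ⟨i, hi⟩ := Function.ne_iff.mp hv
  have hi' : v i ≠ 0 := hi
  have hvec (w : ι → K) : (Matrix.vecMulVec w (Pi.single i (v i)⁻¹)).mulVec v = w := by
    ext j
    simp [Matrix.vecMulVec_mulVec, single_dotProduct, hi']
  rw [← Nat.card_prod]
  have : Finite (Matrix ι κ K) := inferInstanceAs (Finite (ι → κ → K))
  refine Nat.card_le_card_of_injective
    (fun p : {R : Matrix ι κ K | R.mulVec v = 0} × (ι → K) ↦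
      p.1.1 + Matrix.vecMulVec p.2 (Pi.single i (v i)⁻¹)) ?_
  rintro ⟨⟨R, hR⟩, w⟩ ⟨⟨R', hR'⟩, w'⟩ h
  simp only [Set.mem_ofPred_eq] at hR hR' h
  have hw : w = w' := by
    simpa [Matrix.add_mulVec, hR, hR', hvec] using congrArg (fun A ↦ A.mulVec v) h
  subst hw
  simpa using h

/-- A nonzero vector is killed by a uniformly random matrix with `d` rows over `K` with
probability at most `|K|⁻ᵈ`. -/
theorem PMF.uniformOfFintype_mulVec_eq_zero_le {K ι κ : Type*} [Field K] [Fintype K]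
    [Fintype ι] [Fintype κ] [Fintype (Matrix ι κ K)] {v : κ → K} (hv : v ≠ 0) :
    (PMF.uniformOfFintype (Matrix ι κ K)).toOuterMeasure {R | R.mulVec v = 0} ≤
      ((Fintype.card K : ℝ≥0∞) ^ Fintype.card ι)⁻¹ := by
  classical
  have hcard := Matrix.card_mulVec_eq_zero_mul_card_le (ι := ι) hv
  simp only [Nat.card_eq_fintype_card, Fintype.card_fun] at hcard
  rw [PMF.toOuterMeasure_uniformOfFintype_apply]
  refine ENNReal.div_le_of_le_mul ?_
  rw [mul_comm, ← div_eq_mul_inv, ENNReal.le_div_iff_mul_le (by simp) (by simp)]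
  exact_mod_cast hcard

/-- Let `R ∈ F_q^{d×m}` be uniformly random with `m < d`. For every fixed matrix
`Sg ∈ F_q^{m×n}` with pairwise distinct columns, the columns of `R * Sg` are
pairwise distinct with probability at least `1 − q^{−(d−m)}`. -/
theorem stmt2 (q m d n : ℕ) [Fact q.Prime] (hm : 0 < m) (hmd : m < d)
    (Sg : Matrix (Fin m) (Fin n) (ZMod q))
    (hSg : Function.Injective fun j : Fin n => (fun r : Fin m => Sg r j)) :
    1 - ((q : ℝ≥0∞) ^ (d - m))⁻¹ ≤
      (PMF.uniformOfFintype (Matrix (Fin d) (Fin m) (ZMod q))).toOuterMeasure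
        {R | Function.Injective fun j : Fin n => R.mulVec (fun r : Fin m => Sg r j)} := by
  have hq0 : (q : ℝ≥0∞) ≠ 0 := by exact_mod_cast (Fact.out : q.Prime).ne_zero
  set P := (PMF.uniformOfFintype (Matrix (Fin d) (Fin m) (ZMod q))).toOuterMeasure
  set good : Set (Matrix (Fin d) (Fin m) (ZMod q)) :=
    {R | Function.Injective fun j : Fin n => R.mulVec (fun r : Fin m => Sg r j)}
  set bad : Set (Matrix (Fin d) (Fin m) (ZMod q)) :=
    ⋃ v ∈ (Finset.univ.filter fun v : Fin m → ZMod q ↦ v ≠ 0), {R | R.mulVec v = 0}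
  have hcover : Set.univ ⊆ good ∪ bad := by
    intro R _
    by_contra hR
    simp only [Set.mem_union, not_or] at hR
    refine hR.1 fun j k hjk ↦ hSg ?_
    by_contra hne
    refine hR.2 (Set.mem_biUnion (x := (fun r ↦ Sg r j) - fun r ↦ Sg r k) ?_ ?_)
    · simpa [sub_eq_zero] using hne
    · simpa [Matrix.mulVec_sub, sub_eq_zero] using hjk
  have hbad : P bad ≤ ((q : ℝ≥0∞) ^ (d - m))⁻¹ := calc
    P bad ≤ ∑ v ∈ Finset.univ.filter (fun v : Fin m → ZMod q ↦ v ≠ 0), P {R | R.mulVec v = 0} :=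
      MeasureTheory.measure_biUnion_finset_le _ _
    _ ≤ ∑ v ∈ Finset.univ.filter (fun v : Fin m → ZMod q ↦ v ≠ 0), ((q : ℝ≥0∞) ^ d)⁻¹ := by
      refine Finset.sum_le_sum fun v hv ↦ ?_
      exact (PMF.uniformOfFintype_mulVec_eq_zero_le (Finset.mem_filter.mp hv).2).trans_eq
        (by simp [ZMod.card])
    _ ≤ ∑ _v : Fin m → ZMod q, ((q : ℝ≥0∞) ^ d)⁻¹ :=
      Finset.sum_le_sum_of_subset (Finset.filter_subset _ _)
    _ = (q : ℝ≥0∞) ^ m * ((q : ℝ≥0∞) ^ d)⁻¹ := by simp [ZMod.card]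
    _ = ((q : ℝ≥0∞) ^ (d - m))⁻¹ := by
      obtain ⟨k, rfl⟩ := Nat.exists_eq_add_of_lt hmd
      rw [show m + k + 1 - m = k + 1 by omega, add_assoc, pow_add,
        ENNReal.mul_inv (by simp [hq0]) (by simp [hq0]), ← mul_assoc,
        ENNReal.mul_inv_cancel (by simp [hq0]) (by simp), one_mul]
  have huniv : P Set.univ = 1 :=
    (PMF.toOuterMeasure_apply_eq_one_iff _ _).mpr (Set.subset_univ _)
  rw [tsub_le_iff_right, ← huniv]
  calc P Set.univ ≤ P (good ∪ bad) := MeasureTheory.measure_mono hcover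
    _ ≤ P good + P bad := MeasureTheory.measure_union_le _ _
    _ ≤ P good + ((q : ℝ≥0∞) ^ (d - m))⁻¹ := by gcongr
end

section
/- Let q be a prime and d, n positive integers with n < q^d. Let X ∈ F_q^{d×n} be a random matrix whose columns x_1, …, x_n are pairwise independent random vectors, each uniformly distributed on F_q^d, and let A ⊆ F_q^d × L be sampled by the MatrixToSet procedure from X and a set L = {ℓ_1, …, ℓ_n} of n distinct labels. Then: (1) Pr[(v, ℓ_i) ∈ A] = q^{−d} for every v ∈ F_q^d and every i ∈ [n]; and (2) for any two distinct labeled vectors (v, ℓ_i) ≠ (u, ℓ_j) in F_q^d × L, the events {(v, ℓ_i) ∈ A} and {(u, ℓ_j) ∈ A} are independent. -/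
open scoped ENNReal

/-- The `MatrixToSet` procedure: given (the joint distribution `ν` of) a random matrix
`X ∈ F_q^{d×n}` with columns `x_1, …, x_n`, output a random set
`A ⊆ F_q^d × [n]` of labeled vectors, sampled — with fresh randomness independent
of `X` — as follows: with probability `1 − q^{−d}` (realized by a uniform auxiliary
vector `h` being nonzero), `A = {(x_i, i) : i ∈ [n]}`; with the remaining
probability `q^{−d}`, every label `i` independently with probability `q^{−d}`
(realized by a uniform auxiliary vector `g i` being zero) contributes all elements
`{(v, i) : v ∈ F_q^d}` to `A`. -/
noncomputable def matrixToSet {q d n : ℕ} [Fact q.Prime]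
    (ν : PMF (Fin n → (Fin d → ZMod q))) :
    PMF (Set ((Fin d → ZMod q) × Fin n)) := do
  let x ← ν
  let h ← PMF.uniformOfFintype (Fin d → ZMod q)
  let g ← PMF.uniformOfFintype (Fin n → (Fin d → ZMod q))
  if h ≠ 0 then
    pure {p | x p.2 = p.1}
  else
    pure {p | g p.2 = 0}

open Finset in
/-- A uniformly random function vanishes on `T` with probability `|V|⁻¹ ^ |T|`. -/
theorem toOuterMeasure_uniformOfFintype_vanish {ι V : Type*} [Fintype ι] [DecidableEq ι]
    [Fintype V] [DecidableEq V] [Zero V] (T : Finset ι) :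
    (PMF.uniformOfFintype (ι → V)).toOuterMeasure {g | ∀ k ∈ T, g k = 0}
      = ((Fintype.card V : ℝ≥0∞)⁻¹) ^ #T := by
  classical
  have hN : (Fintype.card V : ℝ≥0∞) ≠ 0 := by
    simp
  have hN' : (Fintype.card V : ℝ≥0∞) ≠ ∞ := ENNReal.natCast_ne_top _
  have hcard : Fintype.card {g : ι → V | ∀ k ∈ T, g k = 0} * Fintype.card V ^ #T
      = Fintype.card (ι → V) := by
    have hset : {g : ι → V | ∀ k ∈ T, g k = 0}.toFinset
        = Fintype.piFinset (fun k => if k ∈ T then ({0} : Finset V) else univ) := by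
      ext g
      simp only [Set.mem_toFinset, Set.mem_ofPred_eq, Fintype.mem_piFinset]
      refine forall_congr' fun k => ?_
      by_cases hk : k ∈ T <;> simp [hk]
    rw [← Set.toFinset_card, hset, Fintype.card_piFinset, Fintype.card_pi]
    have : ∀ k, #(if k ∈ T then ({0} : Finset V) else univ)
        = if k ∈ T then 1 else Fintype.card V := fun k => by
      by_cases hk : k ∈ T <;> simp [hk]
    have hT : Fintype.card V ^ #T = ∏ k, if k ∈ T then Fintype.card V else 1 := by simp
    rw [hT, ← prod_mul_distrib]
    refine prod_congr rfl fun k _ => ?_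
    by_cases hk : k ∈ T <;> simp [hk]
  rw [PMF.toOuterMeasure_uniformOfFintype_apply, ← hcard, ← ENNReal.inv_pow,
    ENNReal.div_eq_inv_mul, Nat.cast_mul, Nat.cast_pow]
  have hc : (Fintype.card {g : ι → V | ∀ k ∈ T, g k = 0} : ℝ≥0∞) ≠ 0 := by
    have : Nonempty {g : ι → V | ∀ k ∈ T, g k = 0} := ⟨⟨0, by simp⟩⟩
    exact_mod_cast Fintype.card_ne_zero
  have hc' : (Fintype.card {g : ι → V | ∀ k ∈ T, g k = 0} : ℝ≥0∞) ≠ ∞ :=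
    ENNReal.natCast_ne_top _
  rw [ENNReal.mul_inv (Or.inl hc) (Or.inl hc'), mul_right_comm, ENNReal.inv_mul_cancel hc hc',
    one_mul]

/-- The output distribution of `matrixToSet` is a mixture of the two cases of the procedure. -/
theorem toOuterMeasure_matrixToSet {q d n : ℕ} [Fact q.Prime]
    (ν : PMF (Fin n → (Fin d → ZMod q))) :
    ∃ c : ℝ≥0∞, c + ((q : ℝ≥0∞) ^ d)⁻¹ = 1 ∧
      ∀ S : Set (Set ((Fin d → ZMod q) × Fin n)), (matrixToSet ν).toOuterMeasure S
        = c * ν.toOuterMeasure {x | {p | x p.2 = p.1} ∈ S}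
          + ((q : ℝ≥0∞) ^ d)⁻¹ * (PMF.uniformOfFintype (Fin n → (Fin d → ZMod q))).toOuterMeasure
            {g | {p : (Fin d → ZMod q) × Fin n | g p.2 = 0} ∈ S} := by
  classical
  set μ := PMF.uniformOfFintype (Fin d → ZMod q)
  have hμ : ∀ h, μ h = ((q : ℝ≥0∞) ^ d)⁻¹ := fun h => by
    simp [μ, PMF.uniformOfFintype_apply, ZMod.card]
  have hsplit : ∀ a b : ℝ≥0∞, ∑' h, μ h * (if h ≠ 0 then a else b)
      = (∑ h ∈ Finset.univ.erase 0, μ h) * a + ((q : ℝ≥0∞) ^ d)⁻¹ * b := fun a b => by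
    rw [tsum_fintype, ← Finset.sum_erase_add _ _ (Finset.mem_univ (0 : Fin d → ZMod q)),
      Finset.sum_mul, hμ 0]
    congr 1
    · refine Finset.sum_congr rfl fun h hh => ?_
      rw [if_pos (Finset.ne_of_mem_erase hh)]
    · simp
  refine ⟨∑ h ∈ Finset.univ.erase 0, μ h, ?_, fun S => ?_⟩
  · have := hsplit 1 1
    simp only [ite_self, mul_one, PMF.tsum_coe] at this
    exact this.symm
  · have hx : ∀ (x : Fin n → Fin d → ZMod q) (h : Fin d → ZMod q),
        ((PMF.uniformOfFintype (Fin n → (Fin d → ZMod q))).bind fun g =>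
          if h ≠ 0 then PMF.pure {p : (Fin d → ZMod q) × Fin n | x p.2 = p.1}
          else PMF.pure {p | g p.2 = 0}).toOuterMeasure S
        = if h ≠ 0 then (if {p : (Fin d → ZMod q) × Fin n | x p.2 = p.1} ∈ S then 1 else 0)
          else (PMF.uniformOfFintype (Fin n → (Fin d → ZMod q))).toOuterMeasure
            {g | {p : (Fin d → ZMod q) × Fin n | g p.2 = 0} ∈ S} := fun x h => by
      by_cases hh : h = 0
      · simp only [hh, ne_eq, not_true_eq_false, if_false, PMF.toOuterMeasure_bind_apply,
          PMF.toOuterMeasure_pure_apply]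
        rw [PMF.toOuterMeasure_apply]
        refine tsum_congr fun g => ?_
        simp [Set.indicator_apply]
      · simp only [ne_eq, hh, not_false_eq_true, if_true, PMF.bind_const,
          PMF.toOuterMeasure_pure_apply]
    change (ν.bind fun x => μ.bind fun h =>
      (PMF.uniformOfFintype (Fin n → (Fin d → ZMod q))).bind fun g =>
        if h ≠ 0 then PMF.pure {p : (Fin d → ZMod q) × Fin n | x p.2 = p.1}
        else PMF.pure {p | g p.2 = 0}).toOuterMeasure S = _
    rw [PMF.toOuterMeasure_bind_apply]
    simp_rw [PMF.toOuterMeasure_bind_apply μ, hx, hsplit, mul_add]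
    rw [ENNReal.tsum_add, ENNReal.tsum_mul_right, PMF.tsum_coe, one_mul]
    congr 1
    rw [PMF.toOuterMeasure_apply ν, ← ENNReal.tsum_mul_left]
    refine tsum_congr fun x => ?_
    rw [mul_left_comm]
    simp [Set.indicator_apply]

/-- If the columns `x_1, …, x_n` of a random matrix `X ∈ F_q^{d×n}` (with joint
distribution `ν`) are pairwise independent and each uniform on `F_q^d`, and
`n < q^d`, then the random labeled set `A` produced by `MatrixToSet` satisfies:
(1) `Pr[(v,i) ∈ A] = q^{−d}` for every labeled vector `(v,i)`, and
(2) membership events of any two distinct labeled vectors are independent. -/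
theorem stmt3 (q d n : ℕ) [Fact q.Prime] (hn : 0 < n) (hnq : n < q ^ d)
    (ν : PMF (Fin n → (Fin d → ZMod q)))
    (hunif : ∀ (i : Fin n) (v : Fin d → ZMod q),
      ν.toOuterMeasure {x | x i = v} = ((q : ℝ≥0∞) ^ d)⁻¹)
    (hpw : ∀ (i j : Fin n), i ≠ j → ∀ (v u : Fin d → ZMod q),
      ν.toOuterMeasure {x | x i = v ∧ x j = u}
        = ((q : ℝ≥0∞) ^ d)⁻¹ * ((q : ℝ≥0∞) ^ d)⁻¹) :
    (∀ (v : Fin d → ZMod q) (i : Fin n),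
      (matrixToSet ν).toOuterMeasure {A | (v, i) ∈ A} = ((q : ℝ≥0∞) ^ d)⁻¹) ∧
    (∀ (v u : Fin d → ZMod q) (i j : Fin n), (v, i) ≠ (u, j) →
      (matrixToSet ν).toOuterMeasure {A | (v, i) ∈ A ∧ (u, j) ∈ A}
        = (matrixToSet ν).toOuterMeasure {A | (v, i) ∈ A}
          * (matrixToSet ν).toOuterMeasure {A | (u, j) ∈ A}) := by
  obtain ⟨c, hc, hmix⟩ := toOuterMeasure_matrixToSet ν
  have hvanish : ∀ T : Finset (Fin n),
      (PMF.uniformOfFintype (Fin n → (Fin d → ZMod q))).toOuterMeasure {g | ∀ k ∈ T, g k = 0}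
        = (((q : ℝ≥0∞) ^ d)⁻¹) ^ T.card := fun T => by
    rw [toOuterMeasure_uniformOfFintype_vanish]
    simp [ZMod.card]
  have hmem : ∀ (v : Fin d → ZMod q) (i : Fin n),
      (matrixToSet ν).toOuterMeasure {A | (v, i) ∈ A} = ((q : ℝ≥0∞) ^ d)⁻¹ := fun v i => by
    have hg := hvanish {i}
    simp only [Finset.mem_singleton, forall_eq, Finset.card_singleton, pow_one] at hg
    rw [hmix]
    simp only [Set.mem_ofPred_eq]
    rw [hunif, hg, ← add_mul, hc, one_mul]
  refine ⟨hmem, fun v u i j hne => ?_⟩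
  rw [hmem, hmem, hmix]
  simp only [Set.mem_ofPred_eq]
  by_cases hij : i = j
  · subst hij
    have hvu : v ≠ u := fun h => hne (by rw [h])
    have hempty : {x : Fin n → Fin d → ZMod q | x i = v ∧ x i = u} = ∅ :=
      Set.eq_empty_of_forall_notMem fun x hx => hvu (hx.1.symm.trans hx.2)
    have hg := hvanish {i}
    simp only [Finset.mem_singleton, forall_eq, Finset.card_singleton, pow_one] at hg
    simp only [and_self]
    rw [hempty, hg, MeasureTheory.measure_empty, mul_zero, zero_add]
  · have hg := hvanish {i, j}
    simp only [Finset.mem_insert, Finset.mem_singleton, forall_eq_or_imp, forall_eq,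
      Finset.card_pair hij] at hg
    rw [hpw i j hij, hg, pow_two, ← add_mul, hc, one_mul]
end

section
/- Let d > 2, let q be a prime, let c be a positive integer with q^{c−1} ≥ d, and let E = F_q^d × [d]. There exists a probability distribution D over subsets A ⊆ E such that: (a) the membership events {e ∈ A}_{e∈E} are pairwise independent; (b) Pr[e ∈ A] = q^{−d} for every e ∈ E; (c) E[|A|] = d; and (d) E[rank(A)] ≤ c + d·q^{−d} ≤ c + 1. Consequently, every contention resolution scheme φ for D satisfies Σ_{e∈E} Pr[e ∈ φ(A)] ≤ c + 1 while Σ_{e∈E} Pr[e ∈ A] = d; in particular, no contention resolution scheme for D is c′-balanced for any c′ > (c+1)/(d·(1 − q^{−d})). -/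
open scoped ENNReal

/-- A set of labeled vectors in `F_q^d × [d]` is independent if the first-coordinate
map is injective on it and the image is a linearly independent set of vectors. -/
def LabIndep (q d : ℕ) [Fact q.Prime] (S : Finset ((Fin d → ZMod q) × Fin d)) : Prop :=
  Set.InjOn Prod.fst (S : Set ((Fin d → ZMod q) × Fin d)) ∧
    LinearIndependent (ZMod q)
      (fun v : (Prod.fst '' (S : Set ((Fin d → ZMod q) × Fin d))) => (v : Fin d → ZMod q))

/-- The rank of a set of labeled vectors: the dimension of the span of its first
coordinates. -/
noncomputable def labRank (q d : ℕ) [Fact q.Prime]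
    (S : Finset ((Fin d → ZMod q) × Fin d)) : ℕ :=
  Module.finrank (ZMod q)
    (Submodule.span (ZMod q) (Prod.fst '' (S : Set ((Fin d → ZMod q) × Fin d))))

namespace PMF

theorem tsum_bind_mul {α β : Type*} (p : PMF α) (f : α → PMF β) (g : β → ℝ≥0∞) :
    ∑' b, (p.bind f) b * g b = ∑' a, p a * ∑' b, f a b * g b := by
  simp_rw [bind_apply, ← ENNReal.tsum_mul_right, ← ENNReal.tsum_mul_left]
  rw [ENNReal.tsum_comm]
  simp_rw [mul_assoc]

theorem tsum_map_mul {α β : Type*} (p : PMF α) (f : α → β) (g : β → ℝ≥0∞) :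
    ∑' b, (p.map f) b * g b = ∑' a, p a * g (f a) := by
  classical
  rw [← bind_pure_comp, tsum_bind_mul]
  refine tsum_congr fun a => ?_
  congr 1
  rw [tsum_eq_single (f a)]
  · simp
  · intro b hb
    simp [hb]

theorem tsum_mul_card {α : Type*} [Fintype α] (p : PMF (Finset α)) :
    ∑' A, p A * (A.card : ℝ≥0∞) = ∑ e, p.toOuterMeasure {A | e ∈ A} := by
  classical
  simp_rw [toOuterMeasure_apply_fintype]
  rw [Finset.sum_comm, tsum_fintype]
  refine Finset.sum_congr rfl fun A _ => ?_
  simp [Set.indicator_apply, Finset.sum_ite_mem, mul_comm]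

theorem toOuterMeasure_uniformOfFintype_ker {G H : Type*} [AddGroup G] [AddGroup H] [Fintype G]
    [Finite H] (f : G →+ H) (hf : Function.Surjective f) :
    (uniformOfFintype G).toOuterMeasure {x | f x = 0} = (Nat.card H : ℝ≥0∞)⁻¹ := by
  classical
  have hcard : Nat.card f.ker * Nat.card H = Nat.card G := by
    rw [← AddSubgroup.card_mul_index f.ker, AddSubgroup.index_ker, AddMonoidHom.range_eq_top.2 hf,
      AddSubgroup.card_top]
  have hker : Fintype.card {x | f x = 0} = Nat.card f.ker := by
    rw [← Nat.card_eq_fintype_card]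
    rfl
  have hpos : (Nat.card f.ker : ℝ≥0∞) ≠ 0 := by
    exact_mod_cast Nat.card_pos.ne'
  rw [toOuterMeasure_uniformOfFintype_apply, hker, ← Nat.card_eq_fintype_card (α := G), ← hcard,
    Nat.cast_mul, ENNReal.div_eq_inv_mul, ENNReal.mul_inv (Or.inl hpos) (Or.inr (by
      exact_mod_cast Nat.card_pos.ne')), mul_right_comm,
    ENNReal.inv_mul_cancel hpos (ENNReal.natCast_ne_top _), one_mul]

end PMF

section AffineIncidence

variable {K F V ι κ : Type*} [Field K] [Field F] [Algebra K F] [AddCommGroup V] [Module K V]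
  [Fintype κ]

/-- The defect `(b₀ + ∑ k, u i k • b k) - a * ψ v` of a labeled vector `(v, i)` with respect to
the parameter `(a, b₀, b)`. -/
def labelDefect (ψ : V ≃ₗ[K] F) (u : ι → κ → K) (x : V × ι) : F × F × (κ → F) →+ F where
  toFun ω := ω.2.1 + ∑ k, u x.2 k • ω.2.2 k - ω.1 * ψ x.1
  map_zero' := by simp
  map_add' ω η := by
    simp only [Prod.fst_add, Prod.snd_add, Pi.add_apply, smul_add, Finset.sum_add_distrib]
    ring

theorem labelDefect_apply (ψ : V ≃ₗ[K] F) (u : ι → κ → K) (x : V × ι) (ω : F × F × (κ → F)) :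
    labelDefect ψ u x ω = ω.2.1 + ∑ k, u x.2 k • ω.2.2 k - ω.1 * ψ x.1 := rfl

theorem labelDefect_surjective (ψ : V ≃ₗ[K] F) (u : ι → κ → K) (x : V × ι) :
    Function.Surjective (labelDefect ψ u x) := fun y =>
  ⟨(0, y, 0), by simp [labelDefect_apply]⟩

theorem labelDefect_prod_surjective (ψ : V ≃ₗ[K] F) {u : ι → κ → K} (hu : Function.Injective u)
    {x y : V × ι} (hxy : x ≠ y) :
    Function.Surjective ((labelDefect ψ u x).prod (labelDefect ψ u y)) := by
  classical
  rintro ⟨s, t⟩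
  by_cases hi : x.2 = y.2
  · have hv : ψ y.1 - ψ x.1 ≠ 0 := by
      rw [sub_ne_zero]
      exact fun h => hxy (Prod.ext (ψ.injective h).symm hi)
    refine ⟨((s - t) / (ψ y.1 - ψ x.1), s + (s - t) / (ψ y.1 - ψ x.1) * ψ x.1, 0), ?_⟩
    simp only [AddMonoidHom.prod_apply, labelDefect_apply, Pi.zero_apply, smul_zero,
      Finset.sum_const_zero, Prod.mk.injEq]
    constructor
    · ring
    · field_simp
      ring
  · obtain ⟨k, hk⟩ := Function.ne_iff.1 (hu.ne hi)
    have hk' : algebraMap K F (u x.2 k) - algebraMap K F (u y.2 k) ≠ 0 := by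
      rw [sub_ne_zero]
      exact (algebraMap K F).injective.ne hk
    refine ⟨(0, s - u x.2 k •
      ((s - t) / (algebraMap K F (u x.2 k) - algebraMap K F (u y.2 k))),
      Pi.single k ((s - t) / (algebraMap K F (u x.2 k) - algebraMap K F (u y.2 k)))), ?_⟩
    have hsum (i : ι) (z : F) :
        ∑ j, u i j • (Pi.single k z : κ → F) j = u i k • z := by
      rw [Finset.sum_eq_single k]
      · simp
      · intro j _ hj
        simp [hj]
      · simp
    simp only [AddMonoidHom.prod_apply, labelDefect_apply, hsum, Prod.mk.injEq]
    simp only [Algebra.smul_def]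
    constructor
    · ring
    · field_simp
      ring

/-- The set of labeled vectors whose defect vanishes. -/
noncomputable def zeroDefectSet [Fintype V] [Fintype ι] (ψ : V ≃ₗ[K] F) (u : ι → κ → K)
    (ω : F × F × (κ → F)) : Finset (V × ι) :=
  open Classical in Finset.univ.filter fun x => labelDefect ψ u x ω = 0

theorem mem_zeroDefectSet [Fintype V] [Fintype ι] {ψ : V ≃ₗ[K] F} {u : ι → κ → K}
    {ω : F × F × (κ → F)} {x : V × ι} :
    x ∈ zeroDefectSet ψ u ω ↔ labelDefect ψ u x ω = 0 := by
  simp [zeroDefectSet]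

theorem finrank_span_zeroDefectSet_le [Fintype V] [Fintype ι] (ψ : V ≃ₗ[K] F) (u : ι → κ → K)
    {ω : F × F × (κ → F)} (hω : ω.1 ≠ 0) :
    Module.finrank K (Submodule.span K (Prod.fst '' (zeroDefectSet ψ u ω : Set (V × ι))))
      ≤ Fintype.card κ + 1 := by
  let b : Option κ → V := fun o => ψ.symm (ω.1⁻¹ * o.elim ω.2.1 ω.2.2)
  have hspan : Submodule.span K (Prod.fst '' (zeroDefectSet ψ u ω : Set (V × ι)))
      ≤ Submodule.span K (Set.range b) := by
    rw [Submodule.span_le]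
    rintro _ ⟨x, hx, rfl⟩
    have hx0 : ω.2.1 + ∑ k, u x.2 k • ω.2.2 k = ω.1 * ψ x.1 :=
      sub_eq_zero.1 (mem_zeroDefectSet.1 hx)
    have hx1 : x.1 = b none + ∑ k, u x.2 k • b (some k) := by
      apply ψ.injective
      simp only [b, map_add, map_sum, map_smul, LinearEquiv.apply_symm_apply, Option.elim,
        ← mul_smul_comm, ← Finset.mul_sum]
      rw [← mul_add, hx0, inv_mul_cancel_left₀ hω]
    rw [SetLike.mem_coe, hx1]
    exact add_mem (Submodule.subset_span ⟨_, rfl⟩) (sum_mem fun k _ =>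
      Submodule.smul_mem _ _ (Submodule.subset_span ⟨_, rfl⟩))
  have : Module.Finite K (Submodule.span K (Set.range b)) :=
    Module.Finite.span_of_finite K (Set.finite_range b)
  calc _ ≤ Module.finrank K (Submodule.span K (Set.range b)) := Submodule.finrank_mono hspan
    _ ≤ Fintype.card (Option κ) := finrank_range_le_card b
    _ = Fintype.card κ + 1 := Fintype.card_option

end AffineIncidence

section LabeledRank

variable {q d : ℕ} [Fact q.Prime]

theorem labRank_le (S : Finset ((Fin d → ZMod q) × Fin d)) : labRank q d S ≤ d :=
  (Submodule.finrank_le _).trans_eq (by simp)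

theorem LabIndep.card_le_labRank {I A : Finset ((Fin d → ZMod q) × Fin d)} (hI : LabIndep q d I)
    (hIA : I ⊆ A) : I.card ≤ labRank q d A := by
  classical
  have hcard : Module.finrank (ZMod q)
      (Submodule.span (ZMod q) (Prod.fst '' (I : Set ((Fin d → ZMod q) × Fin d)))) = I.card := by
    rw [← Finset.coe_image, finrank_span_finset_eq_card (by
      rw [Finset.coe_image]
      exact hI.2), Finset.card_image_of_injOn hI.1]
  rw [← hcard]
  exact Submodule.finrank_mono (Submodule.span_mono (Set.image_mono (by exact_mod_cast hIA)))

theorem sum_bind_toOuterMeasure_mem_le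
    (D : PMF (Finset ((Fin d → ZMod q) × Fin d)))
    (φ : Finset ((Fin d → ZMod q) × Fin d) → PMF (Finset ((Fin d → ZMod q) × Fin d)))
    (hφ : ∀ A, ∀ I ∈ (φ A).support, I ⊆ A ∧ LabIndep q d I) :
    ∑ e, (D.bind φ).toOuterMeasure {I | e ∈ I} ≤ ∑' A, D A * (labRank q d A : ℝ≥0∞) := by
  rw [← PMF.tsum_mul_card, PMF.tsum_bind_mul]
  gcongr with A
  calc ∑' I, φ A I * (I.card : ℝ≥0∞) ≤ ∑' I, φ A I * (labRank q d A : ℝ≥0∞) := by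
        refine ENNReal.tsum_le_tsum fun I => ?_
        by_cases hI : φ A I = 0
        · simp [hI]
        · have h := hφ A I ((φ A).mem_support_iff I |>.2 hI)
          gcongr
          exact h.2.card_le_labRank h.1
    _ = labRank q d A := by rw [ENNReal.tsum_mul_right, PMF.tsum_coe, one_mul]

end LabeledRank

/-- For `d > 2`, a prime `q`, and a positive integer `c` with `d ≤ q^{c−1}`, there is a
distribution `D` over subsets `A` of `E = F_q^d × [d]` such that:
(a) membership events are pairwise independent; (b) `Pr[e ∈ A] = q^{−d}` for all `e`;
(c) `E[|A|] = d`; (d) `E[rank A] ≤ c + d·q^{−d} ≤ c + 1`. Consequently every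
(randomized) contention resolution scheme `φ` for `D` — i.e. `φ(A)` is always an
independent subset of `A`, with randomness fresh and independent of `A` — satisfies
`∑_{e∈E} Pr[e ∈ φ(A)] ≤ c + 1`, and hence no CRS for `D` is `c'`-balanced
(`Pr[e ∈ φ(A)] ≥ c'·Pr[e ∈ A]` for all `e` with `Pr[e ∈ A] > 0`) for any
`c' > (c+1)/(d·(1 − q^{−d}))`. -/
theorem stmt6 (q c d : ℕ) [Fact q.Prime] (hd : 2 < d) (hc : 0 < c)
    (hcd : d ≤ q ^ (c - 1)) :
    ∃ D : PMF (Finset ((Fin d → ZMod q) × Fin d)),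
      (∀ e f : (Fin d → ZMod q) × Fin d, e ≠ f →
        D.toOuterMeasure {A | e ∈ A ∧ f ∈ A}
          = D.toOuterMeasure {A | e ∈ A} * D.toOuterMeasure {A | f ∈ A}) ∧
      (∀ e : (Fin d → ZMod q) × Fin d,
        D.toOuterMeasure {A | e ∈ A} = ((q : ℝ≥0∞) ^ d)⁻¹) ∧
      (∑' A, D A * (A.card : ℝ≥0∞)) = d ∧
      (∑' A, D A * (labRank q d A : ℝ≥0∞)) ≤ c + d * ((q : ℝ≥0∞) ^ d)⁻¹ ∧
      (c + d * ((q : ℝ≥0∞) ^ d)⁻¹ : ℝ≥0∞) ≤ c + 1 ∧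
      (∀ φ : Finset ((Fin d → ZMod q) × Fin d) → PMF (Finset ((Fin d → ZMod q) × Fin d)),
        (∀ A, ∀ I ∈ (φ A).support, I ⊆ A ∧ LabIndep q d I) →
        (∑ e : (Fin d → ZMod q) × Fin d, (D.bind φ).toOuterMeasure {I | e ∈ I}) ≤ c + 1 ∧
        (∀ c' : ℝ≥0∞,
          (∀ e : (Fin d → ZMod q) × Fin d, 0 < D.toOuterMeasure {A | e ∈ A} →
            c' * D.toOuterMeasure {A | e ∈ A} ≤ (D.bind φ).toOuterMeasure {I | e ∈ I}) →
          c' ≤ (c + 1) / (d * (1 - ((q : ℝ≥0∞) ^ d)⁻¹)))) := by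
  classical
  obtain ⟨m, rfl⟩ : ∃ m, c = m + 1 := ⟨c - 1, by omega⟩
  have hd0 : d ≠ 0 := by omega
  have hq : (1 : ℝ≥0∞) ≤ (q : ℝ≥0∞) ^ d := by
    exact_mod_cast Nat.one_le_pow _ _ (Fact.out : q.Prime).pos
  have hq0 : (q : ℝ≥0∞) ^ d ≠ 0 := (zero_lt_one.trans_le hq).ne'
  have hqt : (q : ℝ≥0∞) ^ d ≠ ⊤ := ENNReal.pow_ne_top (ENNReal.natCast_ne_top q)
  let F := GaloisField q d
  let : Fintype F := Fintype.ofFinite F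
  have hF : Nat.card F = q ^ d := GaloisField.card q d hd0
  obtain ⟨u⟩ : Nonempty (Fin d ↪ (Fin m → ZMod q)) :=
    Function.Embedding.nonempty_of_card_le (by simpa [ZMod.card] using hcd)
  let ψ : (Fin d → ZMod q) ≃ₗ[ZMod q] F :=
    LinearEquiv.ofFinrankEq _ _ (by simp [F, GaloisField.finrank q hd0])
  let P : PMF (F × F × (Fin m → F)) := PMF.uniformOfFintype _
  let D := P.map (zeroDefectSet ψ u)
  have hprob (e : (Fin d → ZMod q) × Fin d) :
      D.toOuterMeasure {A | e ∈ A} = ((q : ℝ≥0∞) ^ d)⁻¹ := by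
    have h := PMF.toOuterMeasure_uniformOfFintype_ker _ (labelDefect_surjective ψ u e)
    rw [hF, Nat.cast_pow] at h
    rw [PMF.toOuterMeasure_map_apply, ← h]
    congr 1
    ext ω
    exact mem_zeroDefectSet
  have hpair (e f : (Fin d → ZMod q) × Fin d) (hef : e ≠ f) :
      D.toOuterMeasure {A | e ∈ A ∧ f ∈ A}
        = D.toOuterMeasure {A | e ∈ A} * D.toOuterMeasure {A | f ∈ A} := by
    have h := PMF.toOuterMeasure_uniformOfFintype_ker _
      (labelDefect_prod_surjective ψ u.injective hef)
    rw [Nat.card_prod, hF, Nat.cast_mul, Nat.cast_pow,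
      ENNReal.mul_inv (Or.inl hq0) (Or.inl hqt)] at h
    rw [hprob, hprob, PMF.toOuterMeasure_map_apply, ← h]
    congr 1
    ext ω
    simp [mem_zeroDefectSet]
  have hsum : ∑ e : (Fin d → ZMod q) × Fin d, D.toOuterMeasure {A | e ∈ A} = d := by
    simp only [hprob, Finset.sum_const, Finset.card_univ, Fintype.card_prod, Fintype.card_pi,
      ZMod.card, Finset.prod_const, Fintype.card_fin, nsmul_eq_mul]
    push_cast
    rw [mul_right_comm, ENNReal.mul_inv_cancel hq0 hqt, one_mul]
  have hrank : ∑' A, D A * (labRank q d A : ℝ≥0∞)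
      ≤ ((m + 1 : ℕ) : ℝ≥0∞) + d * ((q : ℝ≥0∞) ^ d)⁻¹ := by
    have hzero : P.toOuterMeasure {ω | ω.1 = 0} = ((q : ℝ≥0∞) ^ d)⁻¹ := by
      have h := PMF.toOuterMeasure_uniformOfFintype_ker
        (AddMonoidHom.fst F (F × (Fin m → F))) Prod.fst_surjective
      rw [hF, Nat.cast_pow] at h
      exact h
    have hle (ω : F × F × (Fin m → F)) :
        P ω * (labRank q d (zeroDefectSet ψ u ω) : ℝ≥0∞)
          ≤ P ω * (m + 1 : ℕ) + {ω | ω.1 = 0}.indicator P ω * d := by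
      by_cases hω : ω.1 = 0
      · rw [Set.indicator_of_mem (by exact hω)]
        refine le_add_left ?_
        gcongr
        exact labRank_le (zeroDefectSet ψ u ω)
      · refine le_add_right ?_
        gcongr
        simpa [labRank] using finrank_span_zeroDefectSet_le ψ u hω
    calc _ = ∑' ω, P ω * (labRank q d (zeroDefectSet ψ u ω) : ℝ≥0∞) :=
        PMF.tsum_map_mul P (zeroDefectSet ψ u) fun A => (labRank q d A : ℝ≥0∞)
      _ ≤ ∑' ω, (P ω * (m + 1 : ℕ) + {ω | ω.1 = 0}.indicator P ω * d) :=
        ENNReal.tsum_le_tsum hle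
      _ = _ := by
        rw [ENNReal.tsum_add, ENNReal.tsum_mul_right, ENNReal.tsum_mul_right, PMF.tsum_coe,
          one_mul, ← PMF.toOuterMeasure_apply, hzero, mul_comm _ (d : ℝ≥0∞)]
  have hbound : ((m + 1 : ℕ) + d * ((q : ℝ≥0∞) ^ d)⁻¹ : ℝ≥0∞) ≤ (m + 1 : ℕ) + 1 := by
    gcongr
    rw [← div_eq_mul_inv]
    refine ENNReal.div_le_of_le_mul ?_
    rw [one_mul]
    exact_mod_cast (Nat.lt_pow_self (Fact.out : q.Prime).one_lt).le
  refine ⟨D, hpair, hprob, (PMF.tsum_mul_card D).trans hsum, hrank, hbound, fun φ hφ => ?_⟩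
  have hφsum := (sum_bind_toOuterMeasure_mem_le D φ hφ).trans (hrank.trans hbound)
  refine ⟨hφsum, fun c' hc' => ?_⟩
  have hmul : c' * d ≤ (m + 1 : ℕ) + 1 := by
    rw [← hsum, Finset.mul_sum]
    refine (Finset.sum_le_sum fun e _ => hc' e ?_).trans hφsum
    rw [hprob]
    exact ENNReal.inv_pos.2 hqt
  calc c' ≤ ((m + 1 : ℕ) + 1) / d :=
        (ENNReal.le_div_iff_mul_le (Or.inl (by exact_mod_cast hd0))
          (Or.inl (ENNReal.natCast_ne_top d))).2 hmul
    _ ≤ _ := by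
        gcongr
        exact mul_le_of_le_one_right' tsub_le_self
end

section
/- Let E_1, …, E_k be pairwise independent events with p_i = Pr[E_i]. Then Pr[⋁_{i=1}^k E_i] ≥ (Σ_{i=1}^k p_i)/(1 + Σ_{i=1}^k p_i), and moreover Pr[⋁_{i=1}^k E_i] ≥ (1/1.299)·(1 − ∏_{i=1}^k (1 − p_i)); i.e., the probability that at least one event occurs is at least 1/1.299 times the corresponding probability under mutually independent events with the same marginals. -/
open scoped ENNReal

/-- The cubic Taylor polynomial of `exp (-x)` at `0` is a global lower bound. -/
lemma cubic_le_exp_neg (x : ℝ) : 1 - x + x ^ 2 / 2 - x ^ 3 / 6 ≤ Real.exp (-x) := by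
  have hd : ∀ y : ℝ, HasDerivAt (fun y => Real.exp y * (1 - y + y ^ 2 / 2 - y ^ 3 / 6))
      (Real.exp y * (-(y ^ 3) / 6)) y := by
    intro y
    have h1 : HasDerivAt (fun y : ℝ => 1 - y + y ^ 2 / 2 - y ^ 3 / 6)
        (0 - 1 + (2 * y ^ 1 * 1) / 2 - (3 * y ^ 2 * 1) / 6) y :=
      ((((hasDerivAt_const y (1 : ℝ)).sub (hasDerivAt_id y)).add
        (((hasDerivAt_id y).pow 2).div_const 2)).sub (((hasDerivAt_id y).pow 3).div_const 6))
    refine ((Real.hasDerivAt_exp y).mul h1).congr_deriv ?_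
    ring
  have hc : Continuous (fun y : ℝ => Real.exp y * (1 - y + y ^ 2 / 2 - y ^ 3 / 6)) := by
    fun_prop
  have key : Real.exp x * (1 - x + x ^ 2 / 2 - x ^ 3 / 6) ≤ 1 := by
    rcases le_total 0 x with hx | hx
    · have h := antitoneOn_of_deriv_nonpos (convex_Ici (0 : ℝ)) hc.continuousOn
        (fun y _ => (hd y).differentiableAt.differentiableWithinAt) (by
          intro y hy
          rw [interior_Ici, Set.mem_Ioi] at hy
          rw [(hd y).deriv]
          have := Real.exp_pos y
          have := pow_pos hy 3
          nlinarith [mul_pos (Real.exp_pos y) this])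
      simpa using h (Set.mem_Ici.2 le_rfl) (Set.mem_Ici.2 hx) hx
    · have h := monotoneOn_of_deriv_nonneg (convex_Iic (0 : ℝ)) hc.continuousOn
        (fun y _ => (hd y).differentiableAt.differentiableWithinAt) (by
          intro y hy
          rw [interior_Iic, Set.mem_Iio] at hy
          rw [(hd y).deriv]
          have : 0 < (-y) ^ 3 := pow_pos (by linarith) 3
          nlinarith [mul_pos (Real.exp_pos y) this])
      simpa using h (Set.mem_Iic.2 hx) (Set.mem_Iic.2 le_rfl) hx
  have h2 : Real.exp (-x) * Real.exp x = 1 := by rw [← Real.exp_add]; simp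
  have := mul_le_mul_of_nonneg_left key (Real.exp_pos (-x)).le
  rwa [← mul_assoc, h2, one_mul, mul_one] at this

lemma exp_neg_le_cubic {p : ℝ} (h0 : 0 ≤ p) (h1 : p ≤ 1) :
    Real.exp (-p) ≤ 1 - p + p ^ 2 * (1 / 2 - 11 * p / 96) := by
  have h := Real.exp_bound (x := -p) (by rw [abs_neg, abs_of_nonneg h0]; exact h1)
    (n := 4) (by norm_num)
  have h' := (abs_le.1 h).2
  rw [abs_neg, abs_of_nonneg h0] at h'
  norm_num [Finset.sum_range_succ, Nat.factorial] at h'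
  have : p ^ 4 ≤ p ^ 3 := pow_le_pow_of_le_one h0 h1 (by norm_num)
  nlinarith

lemma one_sub_exp_neg_mul_le {s : ℝ} (hs : 0 ≤ s) :
    (1 - Real.exp (-s)) * (1 + s) ≤ 1299 / 1000 * s := by
  rcases le_total s (4 / 5) with h1 | h1
  · have h := cubic_le_exp_neg s
    have h3 : (1 - Real.exp (-s)) * (1 + s) ≤ (s - s ^ 2 / 2 + s ^ 3 / 6) * (1 + s) := by
      gcongr; linarith
    have h4 : s / 2 - s ^ 2 / 3 + s ^ 3 / 6 ≤ 299 / 1000 := by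
      nlinarith [sq_nonneg s, sq_nonneg (s - 4 / 5), mul_nonneg hs (sq_nonneg (s - 4 / 5)),
        mul_nonneg hs (sub_nonneg.2 h1)]
    nlinarith [mul_le_mul_of_nonneg_left h4 hs]
  rcases le_total (3345 / 1000) s with h2 | h2
  · have : (1 - Real.exp (-s)) * (1 + s) ≤ 1 * (1 + s) := by
      gcongr; linarith [Real.exp_pos (-s)]
    linarith
  obtain ⟨x, rfl⟩ : ∃ x, s = 9 / 5 + x := ⟨s - 9 / 5, by ring⟩
  have hx1 : -1 ≤ x := by linarith
  have hx2 : x ≤ 1.545 := by norm_num at h2 ⊢; linarith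
  have hE : (1652 / 10000 : ℝ) ≤ Real.exp (-(9 / 5)) := by
    have h9 : Real.exp (-(9 / 5)) ^ 5 = (Real.exp 1 ^ 9)⁻¹ := by
      rw [← Real.exp_nat_mul, ← Real.exp_nat_mul, ← Real.exp_neg]; norm_num
    refine le_of_pow_le_pow_left₀ (n := 5) (by norm_num) (Real.exp_pos _).le ?_
    rw [h9, le_inv_comm₀ (by norm_num) (by positivity)]
    calc Real.exp 1 ^ 9 ≤ 2.7182818286 ^ 9 := by
          gcongr; exact Real.exp_one_lt_d9.le
      _ ≤ _ := by norm_num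
  have hT : 0 ≤ 1 - x + x ^ 2 / 2 - x ^ 3 / 6 := by
    nlinarith [mul_nonneg (sub_nonneg.2 hx2) (sq_nonneg (x - 3 / 4)), sq_nonneg (x - 3 / 2)]
  have hexp : 1652 / 10000 * (1 - x + x ^ 2 / 2 - x ^ 3 / 6) ≤ Real.exp (-(9 / 5 + x)) := by
    rw [neg_add, Real.exp_add]
    exact mul_le_mul hE (cubic_le_exp_neg x) hT (Real.exp_pos _).le
  have h5 : (1 - Real.exp (-(9 / 5 + x))) * (1 + (9 / 5 + x)) ≤
      (1 - 1652 / 10000 * (1 - x + x ^ 2 / 2 - x ^ 3 / 6)) * (1 + (9 / 5 + x)) := by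
    gcongr
  refine h5.trans ?_
  have h6 : 0.03 ≤ 0.4 + x / 30 - x ^ 2 / 6 := by nlinarith
  nlinarith [mul_le_mul_of_nonneg_left h6 (sq_nonneg x), sq_nonneg (x + 1 / 5)]

/-- Replacing one event of probability `p` by a Poisson mass `p` increases the bound. -/
lemma one_sub_mul_le_one_sub_exp_mul {p u A R : ℝ} (hp0 : 0 ≤ p) (hp1 : p ≤ 1) (hu : 0 ≤ u)
    (hR0 : 0 ≤ R) (hR : R ≤ Real.exp (-u)) (hA : A ≤ p + u + 2 * p * u + u ^ 2) :
    (1 - R * (1 - p)) * A ≤ (1 - R * Real.exp (-p)) * (A + p ^ 2) := by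
  set c : ℝ := 1 / 2 - 11 * p / 96 with hc
  have hc0 : 0 ≤ c := by linarith
  have he := exp_neg_le_cubic hp0 hp1
  have he' : 0 ≤ Real.exp (-p) - (1 - p) := by linarith [Real.add_one_le_exp (-p)]
  have hpoly : c * (p + u + 2 * p * u + u ^ 2) + (1 - p + p ^ 2 * c) ≤ 1 + u + u ^ 2 / 2 := by
    rw [hc]
    nlinarith [mul_nonneg hp0 (sq_nonneg (u - 1 / 2)), mul_nonneg hp0 (sq_nonneg (u - 1)),
      mul_nonneg hu (sub_nonneg.2 hp1), mul_nonneg hp0 (sub_nonneg.2 hp1),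
      mul_nonneg (mul_nonneg hp0 hu) (sub_nonneg.2 hp1),
      mul_nonneg (mul_nonneg hp0 hp0) (sub_nonneg.2 hp1), mul_nonneg hp0 hu,
      mul_nonneg (mul_nonneg hp0 hu) hu]
  have hexp : 1 + u + u ^ 2 / 2 ≤ Real.exp u := Real.quadratic_le_exp_of_nonneg hu
  have hRu : R * Real.exp u ≤ 1 := by
    have := mul_le_mul_of_nonneg_right hR (Real.exp_pos u).le
    rwa [← Real.exp_add, neg_add_cancel, Real.exp_zero] at this
  set B : ℝ := p + u + 2 * p * u + u ^ 2 with hB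
  have hB0 : 0 ≤ B := by positivity
  have h1 : (Real.exp (-p) - (1 - p)) * A + p ^ 2 * Real.exp (-p) ≤ p ^ 2 * Real.exp u := by
    calc _ ≤ (Real.exp (-p) - (1 - p)) * B + p ^ 2 * (1 - p + p ^ 2 * c) := by gcongr
      _ ≤ (p ^ 2 * c) * B + p ^ 2 * (1 - p + p ^ 2 * c) := by
        gcongr; rw [hc]; linarith
      _ = p ^ 2 * (c * B + (1 - p + p ^ 2 * c)) := by ring
      _ ≤ p ^ 2 * Real.exp u := by gcongr; linarith
  nlinarith [mul_le_mul_of_nonneg_left h1 hR0, mul_le_mul_of_nonneg_left hRu (sq_nonneg p)]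

lemma one_sub_exp_mul_prod_mul_le {ι : Type*} (S : Finset ι) (p : ι → ℝ) (h0 : ∀ i, 0 ≤ p i)
    (h1 : ∀ i, p i ≤ 1) (t : ℝ) (ht : 0 ≤ t) :
    (1 - Real.exp (-t) * ∏ i ∈ S, (1 - p i)) *
      ((t + ∑ i ∈ S, p i) + (t + ∑ i ∈ S, p i) ^ 2 - ∑ i ∈ S, p i ^ 2) ≤
    1299 / 1000 * (t + ∑ i ∈ S, p i) ^ 2 := by
  classical
  induction S using Finset.induction_on generalizing t with
  | empty =>
    have := mul_le_mul_of_nonneg_right (one_sub_exp_neg_mul_le ht) ht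
    simp only [Finset.prod_empty, Finset.sum_empty]
    linarith
  | insert a S ha ih =>
    have hσ : 0 ≤ ∑ i ∈ S, p i := Finset.sum_nonneg fun i _ => h0 i
    have hq : 0 ≤ ∑ i ∈ S, p i ^ 2 := Finset.sum_nonneg fun i _ => sq_nonneg _
    have hP0 : 0 ≤ ∏ i ∈ S, (1 - p i) := Finset.prod_nonneg fun i _ => sub_nonneg.2 (h1 i)
    have hP : ∏ i ∈ S, (1 - p i) ≤ Real.exp (-∑ i ∈ S, p i) := by
      rw [← Finset.sum_neg_distrib, Real.exp_sum]
      exact Finset.prod_le_prod (fun i _ => sub_nonneg.2 (h1 i))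
        fun i _ => Real.one_sub_le_exp_neg (p i)
    have hstep := one_sub_mul_le_one_sub_exp_mul (h0 a) (h1 a) (add_nonneg ht hσ)
      (R := Real.exp (-t) * ∏ i ∈ S, (1 - p i))
      (A := (t + (p a + ∑ i ∈ S, p i)) + (t + (p a + ∑ i ∈ S, p i)) ^ 2 -
        (p a ^ 2 + ∑ i ∈ S, p i ^ 2)) (by positivity)
      (by rw [neg_add, Real.exp_add]; gcongr) (by nlinarith)
    have hih := ih (t + p a) (add_nonneg ht (h0 a))
    rw [neg_add, Real.exp_add] at hih
    rw [Finset.sum_insert ha, Finset.sum_insert ha, Finset.prod_insert ha]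
    calc _ = _ := by ring
      _ ≤ _ := hstep
      _ = _ := by ring
      _ ≤ _ := hih
      _ = _ := by ring

open MeasureTheory in
/-- The second moment bound for the probability of a union. -/
lemma two_mul_sum_sub_sq_mul_le_measureReal_iUnion {Ω ι : Type*} [MeasurableSpace Ω] [Fintype ι]
    (μ : Measure Ω) [IsProbabilityMeasure μ] (E : ι → Set Ω) (hE : ∀ i, MeasurableSet (E i))
    (l : ℝ) :
    2 * l * ∑ i, μ.real (E i) - l ^ 2 * ∑ i, ∑ j, μ.real (E i ∩ E j) ≤ μ.real (⋃ i, E i) := by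
  have hI : ∀ s : Set Ω, MeasurableSet s → Integrable (s.indicator (1 : Ω → ℝ)) μ :=
    fun s hs => (integrable_const (1 : ℝ)).indicator hs
  have hU : MeasurableSet (⋃ i, E i) := MeasurableSet.iUnion hE
  have hEE : ∀ i j, MeasurableSet (E i ∩ E j) := fun i j => (hE i).inter (hE j)
  have hI1 : Integrable (fun ω => ∑ i, (E i).indicator (1 : Ω → ℝ) ω) μ :=
    integrable_finsetSum _ fun i _ => hI _ (hE i)
  have hI2' : ∀ i, Integrable (fun ω => ∑ j, (E i ∩ E j).indicator (1 : Ω → ℝ) ω) μ :=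
    fun i => integrable_finsetSum _ fun j _ => hI _ (hEE i j)
  have hI2 : Integrable (fun ω => ∑ i, ∑ j, (E i ∩ E j).indicator (1 : Ω → ℝ) ω) μ :=
    integrable_finsetSum _ fun i _ => hI2' i
  have h1 : ∫ ω, ∑ i, (E i).indicator (1 : Ω → ℝ) ω ∂μ = ∑ i, μ.real (E i) := by
    rw [integral_finsetSum _ fun i _ => hI _ (hE i)]
    exact Finset.sum_congr rfl fun i _ => integral_indicator_one (hE i)
  have h2 : ∫ ω, ∑ i, ∑ j, (E i ∩ E j).indicator (1 : Ω → ℝ) ω ∂μ =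
      ∑ i, ∑ j, μ.real (E i ∩ E j) := by
    rw [integral_finsetSum _ fun i _ => hI2' i]
    refine Finset.sum_congr rfl fun i _ => ?_
    rw [integral_finsetSum _ fun j _ => hI _ (hEE i j)]
    exact Finset.sum_congr rfl fun j _ => integral_indicator_one (hEE i j)
  rw [← h1, ← h2, ← integral_indicator_one hU, ← integral_const_mul, ← integral_const_mul,
    ← integral_sub (hI1.const_mul _) (hI2.const_mul _)]
  refine integral_mono ((hI1.const_mul _).sub (hI2.const_mul _)) (hI _ hU) fun ω => ?_
  have hsq : ∑ i, ∑ j, (E i ∩ E j).indicator (1 : Ω → ℝ) ω =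
      (∑ i, (E i).indicator (1 : Ω → ℝ) ω) ^ 2 := by
    rw [sq, Finset.sum_mul_sum]
    simp [Set.inter_indicator_one]
  simp only [hsq]
  by_cases hω : ω ∈ ⋃ i, E i
  · rw [Set.indicator_of_mem hω, Pi.one_apply]
    nlinarith [sq_nonneg (1 - l * ∑ i, (E i).indicator (1 : Ω → ℝ) ω)]
  · rw [Set.indicator_of_notMem hω]
    rw [Set.mem_iUnion, not_exists] at hω
    simp [hω]

open MeasureTheory in
lemma measureReal_iUnion_bounds_of_pairwise {Ω ι : Type*} [MeasurableSpace Ω] [Fintype ι]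
    (μ : Measure Ω) [IsProbabilityMeasure μ] (E : ι → Set Ω) (hE : ∀ i, MeasurableSet (E i))
    (hpw : ∀ i j, i ≠ j → μ (E i ∩ E j) = μ (E i) * μ (E j)) :
    (∑ i, μ.real (E i)) / (1 + ∑ i, μ.real (E i)) ≤ μ.real (⋃ i, E i) ∧
    1000 / 1299 * (1 - ∏ i, (1 - μ.real (E i))) ≤ μ.real (⋃ i, E i) := by
  classical
  have h0 : ∀ i, 0 ≤ μ.real (E i) := fun i => measureReal_nonneg
  have hA : ∑ i, ∑ j, μ.real (E i ∩ E j) =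
      ∑ i, μ.real (E i) + (∑ i, μ.real (E i)) ^ 2 - ∑ i, μ.real (E i) ^ 2 := by
    rw [sq, Finset.sum_mul_sum, ← Finset.sum_add_distrib, ← Finset.sum_sub_distrib]
    refine Finset.sum_congr rfl fun i _ => ?_
    rw [← Finset.add_sum_erase _ _ (Finset.mem_univ i),
      ← Finset.add_sum_erase (a := i) _ (fun j => μ.real (E i) * μ.real (E j)) (Finset.mem_univ i),
      Set.inter_self, Finset.sum_congr rfl fun j hj => show
        μ.real (E i ∩ E j) = μ.real (E i) * μ.real (E j) by
          simp [Measure.real, hpw i j (Finset.ne_of_mem_erase hj).symm]]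
    ring
  have hmain := two_mul_sum_sub_sq_mul_le_measureReal_iUnion μ E hE
  rw [hA] at hmain
  have hprod := one_sub_exp_mul_prod_mul_le Finset.univ (fun i => μ.real (E i)) h0
    (fun i => measureReal_le_one) 0 le_rfl
  have hq : ∑ i, μ.real (E i) ^ 2 ≤ (∑ i, μ.real (E i)) ^ 2 :=
    Finset.sum_sq_le_sq_sum_of_nonneg fun i _ => h0 i
  have hq0 : 0 ≤ ∑ i, μ.real (E i) ^ 2 := Finset.sum_nonneg fun i _ => sq_nonneg _
  rcases (Finset.sum_nonneg fun i _ => h0 i : 0 ≤ ∑ i, μ.real (E i)).eq_or_lt with hs | hs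
  · have hz : ∀ i, μ.real (E i) = 0 := fun i =>
      (Finset.sum_eq_zero_iff_of_nonneg fun i _ => h0 i).1 hs.symm i (Finset.mem_univ i)
    simp [hz]
  simp only [neg_zero, Real.exp_zero, one_mul, zero_add] at hprod
  set s := ∑ i, μ.real (E i)
  set q := ∑ i, μ.real (E i) ^ 2
  set A := s + s ^ 2 - q with hAdef
  have hApos : 0 < A := by linarith
  have hP : s ^ 2 / A ≤ μ.real (⋃ i, E i) := by
    refine le_trans (le_of_eq ?_) (hmain (s / A))
    field_simp
    ring
  constructor
  · refine le_trans ?_ hP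
    rw [div_le_div_iff₀ (by linarith) hApos]
    nlinarith
  · refine le_trans ?_ hP
    rw [le_div_iff₀ hApos]
    linarith

/-- For pairwise independent events `E_1, …, E_k` with `p_i = Pr[E_i]`:
`Pr[⋁ E_i] ≥ (∑ p_i)/(1 + ∑ p_i)`, and moreover
`Pr[⋁ E_i] ≥ (1/1.299)·(1 − ∏ (1 − p_i))`, i.e. at least `1/1.299 = 1000/1299`
times the probability of the disjunction under mutually independent events with
the same marginals. -/
theorem stmt9 {Ω : Type*} [MeasurableSpace Ω] (μ : MeasureTheory.Measure Ω)
    [MeasureTheory.IsProbabilityMeasure μ]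
    (k : ℕ) (E : Fin k → Set Ω) (hmeas : ∀ i, MeasurableSet (E i))
    (hpw : ∀ i j, i ≠ j → μ (E i ∩ E j) = μ (E i) * μ (E j)) :
    (∑ i, μ (E i)) / (1 + ∑ i, μ (E i)) ≤ μ (⋃ i, E i) ∧
    (1000 / 1299 : ℝ≥0∞) * (1 - ∏ i, (1 - μ (E i))) ≤ μ (⋃ i, E i) := by
  obtain ⟨h1, h2⟩ := measureReal_iUnion_bounds_of_pairwise μ E hmeas hpw
  have hne : ∀ i, μ (E i) ≠ ∞ := fun i => MeasureTheory.measure_ne_top μ _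
  have hs : ∑ i, μ (E i) ≠ ∞ := ENNReal.sum_ne_top.2 fun i _ => hne i
  have hle : ∏ i, (1 - μ (E i)) ≤ 1 := Finset.prod_le_one' fun i _ => tsub_le_self
  constructor
  · rw [← ENNReal.toReal_le_toReal (ENNReal.div_ne_top hs (by simp))
      (MeasureTheory.measure_ne_top μ _), ENNReal.toReal_div,
      ENNReal.toReal_add ENNReal.one_ne_top hs, ENNReal.toReal_sum fun i _ => hne i]
    exact h1
  · have hc : (1000 / 1299 : ℝ≥0∞) ≠ ∞ := ENNReal.div_ne_top (by simp) (by simp)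
    rw [← ENNReal.toReal_le_toReal
      (ENNReal.mul_ne_top hc (ENNReal.sub_ne_top ENNReal.one_ne_top))
      (MeasureTheory.measure_ne_top μ _), ENNReal.toReal_mul, ENNReal.toReal_div,
      ENNReal.toReal_sub_of_le hle ENNReal.one_ne_top, ENNReal.toReal_prod]
    simp only [ENNReal.toReal_sub_of_le MeasureTheory.prob_le_one ENNReal.one_ne_top]
    exact h2
end

section
/- Let V be a vector space over F_2 and let B ⊆ V be a finite linearly independent set partitioned into parts P_1, …, P_J, where part P_j has size 2m_j for a positive integer m_j. For each j fix an enumeration P_j = {v^j_1, …, v^j_{2m_j}} and define the windowed sums σ^j_t = v^j_t + v^j_{t+1} + … + v^j_{t+m_j−1} for t = 1, …, m_j. Then the Σ_j m_j vectors {σ^j_t : j ∈ [J], t ∈ [m_j]} are pairwise distinct and linearly independent. -/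
/-- The windowed sums: given for each `j` an enumeration `v j 0, …, v j (2m_j − 1)` of
the part `P_j`, the `t`-th windowed sum is `σ^j_t = v j t + v j (t+1) + … + v j (t + m_j − 1)`
for `t = 0, …, m_j − 1`. -/
def windowSum {V : Type*} [AddCommGroup V] [Module (ZMod 2) V]
    {J : ℕ} {m : Fin J → ℕ} (v : (j : Fin J) → Fin (2 * m j) → V) :
    (Σ j : Fin J, Fin (m j)) → V :=
  fun p => ∑ i : Fin (m p.1),
    v p.1 ⟨(p.2 : ℕ) + (i : ℕ), by
      have h1 := p.2.isLt
      have h2 := i.isLt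
      omega⟩

/-- A family is linearly independent as soon as every member has a linear functional that is
nonzero on it and vanishes on all other members of the same or smaller height. -/
theorem linearIndependent_of_triangular {K V ι : Type*} [Field K] [AddCommGroup V] [Module K V]
    [Fintype ι] (w : ι → V) (height : ι → ℕ) (f : ι → V →ₗ[K] K)
    (hdiag : ∀ p, f p (w p) ≠ 0)
    (hlow : ∀ p q, q ≠ p → height q ≤ height p → f p (w q) = 0) :
    LinearIndependent K w := by
  classical
  rw [Fintype.linearIndependent_iff]
  intro g hg
  by_contra! hne
  obtain ⟨p, hp, hmax⟩ := (Finset.univ.filter fun p => g p ≠ 0).exists_max_image height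
    (hne.imp fun p hp => by simpa using hp)
  have hsum : ∑ q, g q * f p (w q) = 0 := by
    simpa using congrArg (f p) hg
  rw [Finset.sum_eq_single p _ (by simp)] at hsum
  · exact mul_ne_zero (by simpa using hp) (hdiag p) hsum
  · intro q _ hqp
    by_cases hq : g q = 0
    · simp [hq]
    · rw [hlow p q hqp (hmax q (by simpa using hq)), mul_zero]

/-- The members of a linearly independent family over a field have dual functionals. -/
theorem LinearIndependent.exists_dual {K V ι : Type*} [Field K] [AddCommGroup V] [Module K V]
    [DecidableEq ι] {v : ι → V} (hv : LinearIndependent K v) :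
    ∃ f : ι → V →ₗ[K] K, ∀ p q, f p (v q) = if q = p then 1 else 0 := by
  obtain ⟨L, hL⟩ := (Finsupp.linearCombination K v).exists_leftInverse_of_injective
    (LinearMap.ker_eq_bot.mpr hv)
  refine ⟨fun p => Finsupp.lapply p ∘ₗ L, fun p q => ?_⟩
  have h := LinearMap.congr_fun hL (Finsupp.single q 1)
  simp only [LinearMap.comp_apply, Finsupp.linearCombination_single, one_smul,
    LinearMap.id_apply] at h
  simp [h, Finsupp.single_apply]

/-- Let `B ⊆ V` be a finite linearly independent set over `F_2`, partitioned into parts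
`P_1, …, P_J` with `|P_j| = 2 m_j` (encoded by enumerations `v j : Fin (2 m_j) → V`
whose combined family is linearly independent). Then the `∑_j m_j` windowed sums
`σ^j_t` are pairwise distinct and linearly independent. -/
theorem stmt10 {V : Type*} [AddCommGroup V] [Module (ZMod 2) V]
    (J : ℕ) (m : Fin J → ℕ) (hm : ∀ j, 0 < m j)
    (v : (j : Fin J) → Fin (2 * m j) → V)
    (hli : LinearIndependent (ZMod 2)
      (fun p : Σ j : Fin J, Fin (2 * m j) => v p.1 p.2)) :
    Function.Injective (windowSum v) ∧
    LinearIndependent (ZMod 2) (windowSum v) := by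
  suffices h : LinearIndependent (ZMod 2) (windowSum v) from ⟨h.injective, h⟩
  obtain ⟨f, hf⟩ := hli.exists_dual
  let top : (Σ j : Fin J, Fin (m j)) → Σ j : Fin J, Fin (2 * m j) := fun p =>
    ⟨p.1, ⟨p.2 + (m p.1 - 1), by have := p.2.isLt; omega⟩⟩
  refine linearIndependent_of_triangular (windowSum v) (fun p => p.2) (fun p => f (top p)) ?_ ?_
  · rintro ⟨j, t⟩
    have hj := hm j
    rw [windowSum, map_sum, Finset.sum_eq_single ⟨m j - 1, Nat.sub_lt hj one_pos⟩ _ (by simp)]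
    · simp [hf _ ⟨j, _⟩, top]
    · intro i _ hi
      rw [hf _ ⟨j, _⟩, if_neg]
      intro h
      simp only [top, Sigma.mk.injEq, heq_eq_eq, true_and, Fin.mk.injEq] at h
      exact hi (Fin.ext (by simp only; omega))
  · rintro ⟨j, t⟩ ⟨k, s⟩ hne hle
    rw [windowSum, map_sum]
    refine Finset.sum_eq_zero fun i _ => ?_
    rw [hf _ ⟨k, _⟩, if_neg]
    intro h
    simp only [top, Sigma.mk.injEq] at h
    obtain ⟨rfl, h⟩ := h
    simp only [heq_eq_eq, Fin.mk.injEq] at h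
    have hi := i.isLt
    simp only at hle hi
    exact hne (by rw [Fin.ext (by omega : (s : ℕ) = t)])
end

section
/- Let κ ≥ 1 and let d be a positive real (in the intended application d = 2^{2κ}). Let V be a vector space over F_2, let W_1 ⊇ W_2 ⊇ … ⊇ W_{κ+1} be a nested chain of finite-dimensional subspaces of V with dim W_ℓ ≤ d/2^{ℓ−1} for every ℓ ∈ [κ+1], and let A_1, …, A_κ be pairwise disjoint finite linearly independent sets with A_ℓ ⊆ W_ℓ and |A_ℓ| ≥ d/2^ℓ for every ℓ ∈ [κ]. Then there exists a linearly independent set S ⊆ ⋃_{ℓ=1}^κ A_ℓ such that Σ_{ℓ=1}^κ 2^ℓ · |S ∩ A_ℓ| ≥ ⌊κ/2⌋ · d/2. (This is the combinatorial core of the lower bound on the prophet's reward: assigning weight 2^ℓ to the elements of A_ℓ, the maximum-weight independent set has weight Ω(κ·d).) -/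
/-- A linearly independent finset `T` extends, by vectors of a linearly independent finset `A`,
to a linearly independent finset with at least `#A` elements. -/
theorem exists_linearIndepOn_superset_card_le {K V : Type*} [DivisionRing K] [AddCommGroup V]
    [Module K V] [DecidableEq V] {T A : Finset V} (hT : LinearIndepOn K id (T : Set V))
    (hA : LinearIndepOn K id (A : Set V)) :
    ∃ S : Finset V, T ⊆ S ∧ S ⊆ T ∪ A ∧ LinearIndepOn K id (S : Set V) ∧ A.card ≤ S.card := by
  obtain ⟨b, hbTA, hTb, hspan, hb⟩ :=
    exists_linearIndepOn_id_extension hT (t := ((T ∪ A : Finset V) : Set V)) (by simp)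
  lift b to Finset V using (T ∪ A).finite_toSet.subset hbTA
  refine ⟨b, by exact_mod_cast hTb, by exact_mod_cast hbTA, hb, ?_⟩
  have hAb : Submodule.span K (A : Set V) ≤ Submodule.span K (b : Set V) :=
    Submodule.span_le.2 fun x hx => hspan (by simpa using Or.inr hx)
  rw [← finrank_span_finset_eq_card hA, ← finrank_span_finset_eq_card hb]
  exact Submodule.finrank_mono hAb

/-- The greedy independent set for geometric weights: if `A i` is independent with at least
`d / 2 ^ (i + 1)` elements, an independent set in the union has weight at least
`(κ - 1) * d / 2` in excess of twice its cardinality. -/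
theorem exists_linearIndepOn_geometric_weight {K V : Type*} [DivisionRing K] [AddCommGroup V]
    [Module K V] [DecidableEq V] (κ : ℕ) (d : ℝ) (A : Fin κ → Finset V)
    (hli : ∀ i, LinearIndepOn K id (A i : Set V))
    (hcard : ∀ i : Fin κ, d / 2 ^ ((i : ℕ) + 1) ≤ ((A i).card : ℝ)) :
    ∃ S : Finset V, (S : Set V) ⊆ ⋃ i, (A i : Set V) ∧ LinearIndepOn K id (S : Set V) ∧
      (0 < κ → d ≤ 2 * (S.card : ℝ)) ∧
      2 * (S.card : ℝ) + ((κ - 1 : ℕ) : ℝ) * d / 2 ≤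
        ∑ i : Fin κ, (2 : ℝ) ^ ((i : ℕ) + 1) * ((S ∩ A i).card : ℝ) := by
  induction κ generalizing d with
  | zero => exact ⟨∅, by simp, by simp, by simp, by simp⟩
  | succ n ih =>
    obtain ⟨T, hTA, hT, hTcard, hTsum⟩ := ih (d / 2) (fun i => A i.succ) (fun i => hli i.succ)
      fun i => by
        convert hcard i.succ using 1
        rw [Fin.val_succ, pow_succ' _ ((i : ℕ) + 1), div_div]
    obtain ⟨S, hTS, hSTA, hS, hAS⟩ := exists_linearIndepOn_superset_card_le hT (hli 0)
    have hAS' : ((A 0).card : ℝ) ≤ S.card := by exact_mod_cast hAS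
    have hA0 := hcard 0
    simp only [Fin.val_zero, zero_add, pow_one] at hA0
    refine ⟨S, ?_, hS, fun _ => by linarith, ?_⟩
    · intro x hx
      rcases Finset.mem_union.1 (hSTA hx) with h | h
      · obtain ⟨i, hi⟩ := Set.mem_iUnion.1 (hTA h)
        exact Set.mem_iUnion.2 ⟨i.succ, hi⟩
      · exact Set.mem_iUnion.2 ⟨0, h⟩
    · have hnew : (S.card : ℝ) ≤ T.card + (S ∩ A 0).card := by
        have hsub : S ⊆ T ∪ S ∩ A 0 := fun x hx => by
          have := hSTA hx
          simp only [Finset.mem_union, Finset.mem_inter] at this ⊢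
          tauto
        exact_mod_cast (Finset.card_le_card hsub).trans (Finset.card_union_le _ _)
      have hold : 2 * ∑ i : Fin n, (2 : ℝ) ^ ((i : ℕ) + 1) * ((T ∩ A i.succ).card : ℝ) ≤
          ∑ i : Fin n, (2 : ℝ) ^ ((i.succ : ℕ) + 1) * ((S ∩ A i.succ).card : ℝ) := by
        rw [Finset.mul_sum]
        refine Finset.sum_le_sum fun i _ => ?_
        rw [Fin.val_succ, pow_succ' _ ((i : ℕ) + 1), mul_assoc]
        gcongr
      rw [Fin.sum_univ_succ]
      simp only [Fin.val_zero, zero_add, pow_one, Nat.add_sub_cancel]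
      rcases n with _ | m
      · simp only [Nat.cast_zero, zero_mul, zero_div, zero_tsub] at hTsum ⊢
        linarith [Nat.cast_nonneg (α := ℝ) T.card]
      · have := hTcard m.succ_pos
        simp only [Nat.add_sub_cancel] at hTsum
        push_cast at hTsum ⊢
        linarith


/-- Let `κ ≥ 1`, let `d > 0` be a real number, and let `V` be a vector space over `F_2`.
Let `W_1 ⊇ W_2 ⊇ … ⊇ W_{κ+1}` be nested finite-dimensional subspaces with
`dim W_ℓ ≤ d/2^{ℓ−1}` (indexed here by `i = ℓ − 1 ∈ {0, …, κ}`), and let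
`A_1, …, A_κ` be pairwise disjoint finite linearly independent sets with
`A_ℓ ⊆ W_ℓ` and `|A_ℓ| ≥ d/2^ℓ`. Then there is a linearly independent set
`S ⊆ ⋃_ℓ A_ℓ` with `∑_ℓ 2^ℓ·|S ∩ A_ℓ| ≥ ⌊κ/2⌋·d/2`. -/
theorem stmt11 {V : Type*} [AddCommGroup V] [Module (ZMod 2) V] [DecidableEq V]
    (κ : ℕ) (hκ : 1 ≤ κ) (d : ℝ) (hd : 0 < d)
    (W : Fin (κ + 1) → Submodule (ZMod 2) V)
    (hWmono : ∀ i j : Fin (κ + 1), i ≤ j → W j ≤ W i)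
    (hWfin : ∀ i, FiniteDimensional (ZMod 2) (W i))
    (hWdim : ∀ i : Fin (κ + 1), (Module.finrank (ZMod 2) (W i) : ℝ) ≤ d / 2 ^ (i : ℕ))
    (A : Fin κ → Finset V)
    (hdisj : ∀ i j, i ≠ j → Disjoint (A i) (A j))
    (hli : ∀ i, LinearIndependent (ZMod 2) (Subtype.val : {x : V // x ∈ A i} → V))
    (hAW : ∀ i : Fin κ, ∀ x ∈ A i, x ∈ W i.castSucc)
    (hAcard : ∀ i : Fin κ, d / 2 ^ ((i : ℕ) + 1) ≤ ((A i).card : ℝ)) :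
    ∃ S : Finset V,
      (↑S ⊆ ⋃ i, (A i : Set V)) ∧
      LinearIndependent (ZMod 2) (Subtype.val : {x : V // x ∈ S} → V) ∧
      ((κ / 2 : ℕ) : ℝ) * d / 2 ≤ ∑ i : Fin κ, (2 : ℝ) ^ ((i : ℕ) + 1) * ((S ∩ A i).card : ℝ) := by
  obtain ⟨S, hSA, hS, -, hSsum⟩ :=
    exists_linearIndepOn_geometric_weight (K := ZMod 2) κ d A hli hAcard
  refine ⟨S, hSA, hS, le_trans ?_ hSsum⟩
  have hκ2 : ((κ / 2 : ℕ) : ℝ) ≤ ((κ - 1 : ℕ) : ℝ) := by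
    exact_mod_cast (by omega : κ / 2 ≤ κ - 1)
  have : ((κ / 2 : ℕ) : ℝ) * d / 2 ≤ ((κ - 1 : ℕ) : ℝ) * d / 2 := by gcongr
  linarith [Nat.cast_nonneg (α := ℝ) S.card]
end

section
/- Let E be a finite set and let (w_e)_{e∈E} be nonnegative random variables, each with finite expectation, that are pairwise independent (for all distinct e, f ∈ E, the random variables w_e and w_f are independent). Let T ≥ 0 be a threshold and suppose Σ_{e∈E} Pr[w_e ≥ T] ≤ 1/3. Then for every e ∈ E, E[w_e · 1{w_e ≥ T and w_f < T for all f ≠ e}] ≥ (2/3) · E[w_e · 1{w_e ≥ T}]; summing over e, the expected total weight of elements that are the unique element with weight at least T is at least 2/3 of the expected total weight of all elements with weight at least T. -/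
open scoped ENNReal
open MeasureTheory ProbabilityTheory

/-- If `X` and `Y` are independent, then restricting to an event of `Y` multiplies the integral of
`X` over an event of `X` by the probability of the event of `Y`. -/
theorem setIntegral_preimage_inter_preimage_of_indepFun {Ω : Type*} [MeasurableSpace Ω]
    {μ : Measure Ω} {X Y : Ω → ℝ} (hX : Measurable X) (hY : Measurable Y)
    (hXY : IndepFun X Y μ) {s t : Set ℝ} (hs : MeasurableSet s) (ht : MeasurableSet t) :
    ∫ ω in X ⁻¹' s ∩ Y ⁻¹' t, X ω ∂μ = (∫ ω in X ⁻¹' s, X ω ∂μ) * μ.real (Y ⁻¹' t) := by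
  have hφ : Measurable (s.indicator (id : ℝ → ℝ)) := measurable_id.indicator hs
  have hψ : Measurable (t.indicator (1 : ℝ → ℝ)) := measurable_one.indicator ht
  have h := (hXY.comp hφ hψ).integral_mul_eq_mul_integral
    (hφ.comp hX).aestronglyMeasurable (hψ.comp hY).aestronglyMeasurable
  rw [← integral_indicator (hX hs), ← integral_indicator ((hX hs).inter (hY ht)),
    ← integral_indicator_one (hY ht)]
  refine Eq.trans (integral_congr_ae (.of_forall fun ω ↦ ?_)) h
  by_cases h₁ : X ω ∈ s <;> by_cases h₂ : Y ω ∈ t <;> simp [h₁, h₂]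

/-- Removing finitely many events from a set decreases the integral of a nonnegative function by
at most the sum of its integrals over the intersections. -/
theorem setIntegral_le_setIntegral_diff_biUnion_add_sum {Ω ι : Type*} [MeasurableSpace Ω]
    {μ : Measure Ω} {g : Ω → ℝ} (hg : Integrable g μ) (hg₀ : ∀ ω, 0 ≤ g ω) {A : Set Ω}
    (hA : MeasurableSet A) (F : Finset ι) {B : ι → Set Ω} (hB : ∀ i, MeasurableSet (B i)) :
    ∫ ω in A, g ω ∂μ ≤
      ∫ ω in A \ ⋃ i ∈ F, B i, g ω ∂μ + ∑ i ∈ F, ∫ ω in A ∩ B i, g ω ∂μ := by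
  have hU : MeasurableSet (⋃ i ∈ F, B i) := F.measurableSet_biUnion fun i _ ↦ hB i
  have hAB : ∀ i, MeasurableSet (A ∩ B i) := fun i ↦ hA.inter (hB i)
  rw [← integral_indicator hA, ← integral_indicator (hA.diff hU)]
  simp_rw [← integral_indicator (hAB _)]
  rw [← integral_finsetSum F fun i _ ↦ hg.indicator (hAB i),
    ← integral_add (hg.indicator (hA.diff hU))
      (integrable_finsetSum F fun i _ ↦ hg.indicator (hAB i))]
  refine integral_mono (hg.indicator hA) ((hg.indicator (hA.diff hU)).add
    (integrable_finsetSum F fun i _ ↦ hg.indicator (hAB i))) fun ω ↦ ?_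
  have hterm : ∀ i ∈ F, 0 ≤ (A ∩ B i).indicator g ω :=
    fun i _ ↦ Set.indicator_nonneg (fun x _ ↦ hg₀ x) ω
  have hdiff : 0 ≤ (A \ ⋃ i ∈ F, B i).indicator g ω :=
    Set.indicator_nonneg (fun x _ ↦ hg₀ x) ω
  by_cases hωA : ω ∈ A
  · by_cases hωU : ω ∈ ⋃ i ∈ F, B i
    · obtain ⟨i, hi, hωi⟩ := Set.mem_iUnion₂.1 hωU
      have hle := Finset.single_le_sum hterm hi
      rw [Set.indicator_of_mem (show ω ∈ A ∩ B i from ⟨hωA, hωi⟩)] at hle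
      rw [Set.indicator_of_mem hωA]
      exact le_add_of_nonneg_of_le hdiff hle
    · rw [Set.indicator_of_mem hωA,
        Set.indicator_of_mem (show ω ∈ A \ ⋃ i ∈ F, B i from ⟨hωA, hωU⟩)]
      exact le_add_of_nonneg_right (Finset.sum_nonneg hterm)
  · rw [Set.indicator_of_notMem hωA]
    exact add_nonneg hdiff (Finset.sum_nonneg hterm)

/-- Let `(w_e)_{e∈E}` be nonnegative, integrable, pairwise independent random weights,
`T ≥ 0` a threshold with `∑_e Pr[w_e ≥ T] ≤ 1/3`. Then for every `e`,
`E[w_e · 1{w_e ≥ T and w_f < T for all f ≠ e}] ≥ (2/3)·E[w_e · 1{w_e ≥ T}]`. -/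
theorem stmt13 {Ω : Type*} [MeasurableSpace Ω] (μ : Measure Ω) [IsProbabilityMeasure μ]
    {E : Type*} [Fintype E]
    (w : E → Ω → ℝ) (hmeas : ∀ e, Measurable (w e))
    (hnn : ∀ e ω, 0 ≤ w e ω)
    (hint : ∀ e, Integrable (w e) μ)
    (hpw : ∀ e f, e ≠ f → IndepFun (w e) (w f) μ)
    (T : ℝ) (hT : 0 ≤ T)
    (hsum : ∑ e, μ {ω | T ≤ w e ω} ≤ 1 / 3) :
    ∀ e : E,
      (2 / 3) * ∫ ω in {ω | T ≤ w e ω}, w e ω ∂μ ≤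
        ∫ ω in {ω | T ≤ w e ω ∧ ∀ f, f ≠ e → w f ω < T}, w e ω ∂μ := by
  classical
  intro e
  have hset : {ω | T ≤ w e ω ∧ ∀ f, f ≠ e → w f ω < T} =
      {ω | T ≤ w e ω} \ ⋃ f ∈ Finset.univ.erase e, {ω | T ≤ w f ω} := by
    ext ω
    simp
  have hA : ∀ f, MeasurableSet {ω | T ≤ w f ω} :=
    fun f ↦ measurableSet_le measurable_const (hmeas f)
  have hunion := setIntegral_le_setIntegral_diff_biUnion_add_sum (hint e) (hnn e) (hA e)
    (Finset.univ.erase e) hA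
  have hinter : ∀ f ∈ Finset.univ.erase e,
      ∫ ω in {ω | T ≤ w e ω} ∩ {ω | T ≤ w f ω}, w e ω ∂μ =
        (∫ ω in {ω | T ≤ w e ω}, w e ω ∂μ) * μ.real {ω | T ≤ w f ω} := fun f hf ↦
    setIntegral_preimage_inter_preimage_of_indepFun (hmeas e) (hmeas f)
      (hpw e f (Finset.ne_of_mem_erase hf).symm) measurableSet_Ici measurableSet_Ici
  rw [Finset.sum_congr rfl hinter, ← Finset.mul_sum] at hunion
  have hprob : ∑ f ∈ Finset.univ.erase e, μ.real {ω | T ≤ w f ω} ≤ 1 / 3 := by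
    refine (Finset.sum_le_univ_sum_of_nonneg fun f ↦ measureReal_nonneg).trans ?_
    have h := ENNReal.toReal_mono (by simp) hsum
    rw [ENNReal.toReal_sum fun f _ ↦ measure_ne_top μ _] at h
    simpa [Measure.real] using h
  have hpos : 0 ≤ ∫ ω in {ω | T ≤ w e ω}, w e ω ∂μ := integral_nonneg (hnn e)
  rw [hset]
  linarith [mul_le_mul_of_nonneg_left hprob hpos]
end

section
/- Fix κ ≥ 1, d ≥ 1, positive integers n_1, …, n_κ with n = Σ_ℓ n_ℓ, and pairwise disjoint label sets L_1, …, L_κ ⊆ [n] with |L_ℓ| = n_ℓ. Fix matrices Σ_ℓ ∈ F_2^{d×n_ℓ} such that all n columns of the concatenation [Σ_1 … Σ_κ] are nonzero and pairwise distinct. Let R ∈ F_2^{2d×d} be a uniformly random matrix, let X_ℓ = RΣ_ℓ, and, independently for each level ℓ (with mixture randomness independent of R and across levels), let A_ℓ ⊆ F_2^{2d} × L_ℓ be the output of the MatrixToSet procedure applied to X_ℓ and L_ℓ with parameter 2^{−2d}. Define weights on F_2^{2d} × [n] by w(v, i) = 2^ℓ if i ∈ L_ℓ and (v, i) ∈ A_ℓ,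 and w(v, i) = 0 otherwise. Then for any two distinct labeled vectors (v, i) ≠ (u, j) in F_2^{2d} × [n] and any levels ℓ, ℓ′ ∈ [κ]: Pr[w(v, i) = 2^ℓ ∧ w(u, j) = 2^{ℓ′}] = Pr[w(v, i) = 2^ℓ] · Pr[w(u, j) = 2^{ℓ′}]; i.e., the random weights are pairwise independent. -/
open scoped ENNReal

/-- The joint distribution of the random weights on `F_2^{2d} × [n]` produced by the
level construction: sample a uniformly random matrix `R ∈ F_2^{2d×d}`; for each level
`ℓ` sample an independent mixture coin (a uniform vector `h ℓ ∈ F_2^{2d}`, the second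
branch being taken when `h ℓ = 0`, i.e. with probability `2^{−2d}`); and for each
label `i` sample an independent inclusion coin (a uniform vector `g i ∈ F_2^{2d}`,
inclusion happening when `g i = 0`, i.e. with probability `2^{−2d}`). A labeled
vector `(v, i)` with `i ∈ L ℓ` gets weight `2^ℓ` (level `ℓ` being 1-based, i.e.
`2^{ℓidx+1}` for the 0-based index `ℓidx`) when either the first branch is taken at
level `ℓ` and `R·σ_i = v`, or the second branch is taken and the inclusion coin of
label `i` fires; all other weights are `0`. This is exactly the `MatrixToSet`
procedure with parameter `2^{−2d}` applied independently at each level to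
`X_ℓ = R·Σ_ℓ` and labels `L_ℓ`. -/
noncomputable def levelWeights (d n κ : ℕ) (L : Fin κ → Finset (Fin n))
    (σ : Fin n → (Fin d → ZMod 2)) :
    PMF (((Fin (2 * d) → ZMod 2) × Fin n) → ℝ) := do
  let R ← PMF.uniformOfFintype (Matrix (Fin (2 * d)) (Fin d) (ZMod 2))
  let h ← PMF.uniformOfFintype (Fin κ → (Fin (2 * d) → ZMod 2))
  let g ← PMF.uniformOfFintype (Fin n → (Fin (2 * d) → ZMod 2))
  pure fun p => ∑ ℓ : Fin κ,
    if p.2 ∈ L ℓ ∧ ((h ℓ ≠ 0 ∧ R.mulVec (σ p.2) = p.1) ∨ (h ℓ = 0 ∧ g p.2 = 0))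
    then (2 : ℝ) ^ ((ℓ : ℕ) + 1) else 0

/-- A surjective homomorphism of finite groups pushes the uniform distribution to the uniform one. -/
theorem toOuterMeasure_uniformOfFintype_fiber {V W : Type*} [AddGroup V] [AddGroup W] [Fintype V]
    [Fintype W] (φ : V →+ W) (hφ : Function.Surjective φ) (w : W) :
    (PMF.uniformOfFintype V).toOuterMeasure {x | φ x = w} = (Fintype.card W : ℝ≥0∞)⁻¹ := by
  classical
  have hfib : ∀ y : W, (Finset.univ.filter fun x => φ x = y).card
      = (Finset.univ.filter fun x => φ x = w).card := fun y =>
    AddMonoidHom.card_fiber_eq_of_mem_range φ (hφ y) (hφ w)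
  have hcard : Fintype.card V
      = Fintype.card W * (Finset.univ.filter fun x => φ x = w).card := by
    rw [← Finset.card_univ, Finset.card_eq_sum_card_fiberwise (f := φ) (t := Finset.univ)
      (fun _ _ => Finset.mem_coe.2 (Finset.mem_univ _)), Finset.sum_congr rfl fun y _ => hfib y]
    simp
  have hpos : (Finset.univ.filter fun x => φ x = w).card ≠ 0 := by
    obtain ⟨x, hx⟩ := hφ w
    exact Finset.card_ne_zero_of_mem (Finset.mem_filter.2 ⟨Finset.mem_univ x, hx⟩)
  rw [PMF.toOuterMeasure_uniformOfFintype_apply, hcard, Fintype.card_ofFinset, Nat.cast_mul]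
  simp only [Set.mem_ofPred_eq]
  rw [ENNReal.div_eq_inv_mul, ENNReal.mul_inv (Or.inr (ENNReal.natCast_ne_top _))
    (Or.inr (by exact_mod_cast hpos)), mul_assoc, ENNReal.inv_mul_cancel
    (by exact_mod_cast hpos) (ENNReal.natCast_ne_top _), mul_one]

/-- A matrix may be prescribed on linearly independent vectors. -/
theorem LinearIndependent.exists_mulVec_eq {K ι m n : Type*} [Field K] [Fintype ι] [Fintype n]
    [DecidableEq n] {w : ι → n → K} (hw : LinearIndependent K w) (a : ι → m → K) :
    ∃ R : Matrix m n K, ∀ k, R.mulVec (w k) = a k := by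
  classical
  obtain ⟨g, hg⟩ := LinearMap.exists_leftInverse_of_injective (Fintype.linearCombination K w)
    (LinearMap.ker_eq_bot.2 (linearIndependent_iff_injective_fintypeLinearCombination.1 hw))
  refine ⟨LinearMap.toMatrix' (Fintype.linearCombination K a ∘ₗ g), fun k => ?_⟩
  have h := LinearMap.congr_fun hg (Pi.single k 1)
  simp only [LinearMap.comp_apply, Fintype.linearCombination_apply_single, one_smul,
    LinearMap.id_apply] at h
  rw [LinearMap.toMatrix'_mulVec, LinearMap.comp_apply, h, Fintype.linearCombination_apply_single,
    one_smul]

/-- Distinct nonzero vectors over the field with two elements are linearly independent. -/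
theorem linearIndependent_pair_zmod_two {E : Type*} [AddCommGroup E] [Module (ZMod 2) E] {x y : E}
    (hx : x ≠ 0) (hy : y ≠ 0) (hxy : x ≠ y) : LinearIndependent (ZMod 2) ![x, y] := by
  rw [LinearIndependent.pair_iff]
  intro s t h
  have hc : ∀ s : ZMod 2, s = 0 ∨ s = 1 := by decide
  rcases hc s with rfl | rfl <;> rcases hc t with rfl | rfl
  · simp
  · simp [hy] at h
  · simp [hx] at h
  · refine absurd ?_ hxy
    rw [one_smul, one_smul] at h
    have h2 : y + y = 0 := by
      rw [← two_smul (ZMod 2) y, show (2 : ZMod 2) = 0 from rfl, zero_smul]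
    exact add_right_cancel (h.trans h2.symm)

section LevelWeights

variable {d n κ : ℕ} {L : Fin κ → Finset (Fin n)} {σ : Fin n → (Fin d → ZMod 2)}

/-- The labeled vector `(v, i)` belongs to the output of the procedure at level `ℓ`, provided that
`i` is a label of that level. -/
def Selected (σ : Fin n → (Fin d → ZMod 2)) (h : Fin κ → (Fin (2 * d) → ZMod 2))
    (x : Matrix (Fin (2 * d)) (Fin d) (ZMod 2) × (Fin n → (Fin (2 * d) → ZMod 2)))
    (ℓ : Fin κ) (v : Fin (2 * d) → ZMod 2) (i : Fin n) : Prop :=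
  (h ℓ ≠ 0 ∧ x.1.mulVec (σ i) = v) ∨ (h ℓ = 0 ∧ x.2 i = 0)

theorem sum_ite_eq_two_pow_iff (hL : ∀ ℓ ℓ', ℓ ≠ ℓ' → Disjoint (L ℓ) (L ℓ'))
    (P : Fin κ → Prop) [DecidablePred P] (i : Fin n) (ℓ : Fin κ) :
    (∑ k : Fin κ, if i ∈ L k ∧ P k then (2 : ℝ) ^ ((k : ℕ) + 1) else 0) = 2 ^ ((ℓ : ℕ) + 1)
      ↔ i ∈ L ℓ ∧ P ℓ := by
  have huniq : ∀ k k', i ∈ L k → i ∈ L k' → k = k' := fun k k' hk hk' => by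
    by_contra hne
    exact Finset.disjoint_left.1 (hL k k' hne) hk hk'
  have hval : ∀ k, i ∈ L k ∧ P k →
      (∑ k : Fin κ, if i ∈ L k ∧ P k then (2 : ℝ) ^ ((k : ℕ) + 1) else 0)
        = 2 ^ ((k : ℕ) + 1) := fun k hk => by
    rw [Finset.sum_eq_single k (fun b _ hb => if_neg fun h => hb (huniq _ _ h.1 hk.1))
      (fun h => absurd (Finset.mem_univ k) h), if_pos hk]
  refine ⟨fun h => ?_, hval ℓ⟩
  by_cases hex : ∃ k, i ∈ L k ∧ P k
  · obtain ⟨k, hk⟩ := hex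
    rw [hval k hk] at h
    have hkl := pow_right_injective₀ (by norm_num : (0 : ℝ) < 2) (by norm_num) h
    rwa [← Fin.ext (Nat.succ_injective hkl)]
  · push Not at hex
    rw [Finset.sum_eq_zero fun k _ => if_neg fun hk => hex k hk.1 hk.2] at h
    exact absurd h.symm (by positivity)

theorem levelWeights_toOuterMeasure (hL : ∀ ℓ ℓ', ℓ ≠ ℓ' → Disjoint (L ℓ) (L ℓ'))
    (ι : Type*) (v : ι → Fin (2 * d) → ZMod 2) (i : ι → Fin n) (ℓ : ι → Fin κ) :
    (levelWeights d n κ L σ).toOuterMeasure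
        {W | ∀ k, W (v k, i k) = 2 ^ ((ℓ k : ℕ) + 1)}
      = ∑' h, PMF.uniformOfFintype (Fin κ → (Fin (2 * d) → ZMod 2)) h *
        (PMF.uniformOfFintype (Matrix (Fin (2 * d)) (Fin d) (ZMod 2) ×
          (Fin n → (Fin (2 * d) → ZMod 2)))).toOuterMeasure
          {x | ∀ k, i k ∈ L (ℓ k) ∧ Selected σ h x (ℓ k) (v k) (i k)} := by
  classical
  have key : levelWeights d n κ L σ
      = (PMF.uniformOfFintype (Fin κ → (Fin (2 * d) → ZMod 2))).bind fun h =>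
        (PMF.uniformOfFintype (Matrix (Fin (2 * d)) (Fin d) (ZMod 2) ×
          (Fin n → (Fin (2 * d) → ZMod 2)))).map fun x p => ∑ ℓ : Fin κ,
            if p.2 ∈ L ℓ ∧ Selected σ h x ℓ p.1 p.2 then (2 : ℝ) ^ ((ℓ : ℕ) + 1) else 0 := by
    have hprod : PMF.uniformOfFintype (Matrix (Fin (2 * d)) (Fin d) (ZMod 2) ×
          (Fin n → (Fin (2 * d) → ZMod 2)))
        = (PMF.uniformOfFintype _).bind fun R => (PMF.uniformOfFintype _).bind fun g =>
          PMF.pure (R, g) := by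
      ext ⟨R, g⟩
      simp only [PMF.bind_apply, PMF.uniformOfFintype_apply, PMF.pure_apply, Prod.mk.injEq]
      rw [tsum_eq_single R, tsum_eq_single g]
      · simp only [and_self, if_true, mul_one, Fintype.card_prod, Nat.cast_mul]
        rw [ENNReal.mul_inv] <;> simp
      · intro b hb
        simp [hb.symm]
      · intro b hb
        simp [hb.symm]
    simp only [hprod, PMF.map_bind, PMF.pure_map]
    rw [PMF.bind_comm]
    unfold levelWeights Selected
    refine congrArg _ (funext fun R => congrArg _ (funext fun h => congrArg _ (funext fun g => ?_)))
    refine congrArg PMF.pure (funext fun p => Finset.sum_congr rfl fun ℓ _ => ?_)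
    congr
  rw [key, PMF.toOuterMeasure_bind_apply]
  refine tsum_congr fun h => ?_
  rw [PMF.toOuterMeasure_map_apply]
  congr 2
  ext x
  simp only [Set.mem_preimage, Set.mem_ofPred_eq]
  exact forall_congr' fun k =>
    sum_ite_eq_two_pow_iff hL (fun ℓ => Selected σ h x ℓ (v k) (i k)) (i k) (ℓ k)

/-- Distinct labels with linearly independent columns are selected independently. -/
theorem levelWeights_toOuterMeasure_of_linearIndependent
    (hL : ∀ ℓ ℓ', ℓ ≠ ℓ' → Disjoint (L ℓ) (L ℓ'))
    {ι : Type*} [Fintype ι] (v : ι → Fin (2 * d) → ZMod 2) (i : ι → Fin n) (ℓ : ι → Fin κ)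
    (hi : Function.Injective i) (hσ : LinearIndependent (ZMod 2) (σ ∘ i))
    (hmem : ∀ k, i k ∈ L (ℓ k)) :
    (levelWeights d n κ L σ).toOuterMeasure
        {W | ∀ k, W (v k, i k) = 2 ^ ((ℓ k : ℕ) + 1)}
      = ((Fintype.card (Fin (2 * d) → ZMod 2) : ℝ≥0∞)⁻¹) ^ Fintype.card ι := by
  classical
  rw [levelWeights_toOuterMeasure hL]
  have hcond : ∀ h : Fin κ → (Fin (2 * d) → ZMod 2),
      (PMF.uniformOfFintype (Matrix (Fin (2 * d)) (Fin d) (ZMod 2) ×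
          (Fin n → (Fin (2 * d) → ZMod 2)))).toOuterMeasure
          {x | ∀ k, i k ∈ L (ℓ k) ∧ Selected σ h x (ℓ k) (v k) (i k)}
        = ((Fintype.card (Fin (2 * d) → ZMod 2) : ℝ≥0∞)⁻¹) ^ Fintype.card ι := by
    intro h
    let φ : (Matrix (Fin (2 * d)) (Fin d) (ZMod 2) × (Fin n → (Fin (2 * d) → ZMod 2))) →+
        (ι → Fin (2 * d) → ZMod 2) :=
      { toFun := fun x k => if h (ℓ k) = 0 then x.2 (i k) else x.1.mulVec (σ (i k))
        map_zero' := by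
          funext k
          simp
        map_add' := fun x y => by
          funext k
          by_cases hk : h (ℓ k) = 0 <;> simp [hk, Matrix.add_mulVec] }
    have hφ : Function.Surjective φ := fun a => by
      obtain ⟨R, hR⟩ := hσ.exists_mulVec_eq a
      refine ⟨(R, Function.extend i a 0), funext fun k => ?_⟩
      have hRk : R.mulVec (σ (i k)) = a k := hR k
      by_cases hk : h (ℓ k) = 0 <;> simp [φ, hk, hi.extend_apply, hRk]
    have hset : {x | ∀ k, i k ∈ L (ℓ k) ∧ Selected σ h x (ℓ k) (v k) (i k)}
        = {x | φ x = fun k => if h (ℓ k) = 0 then 0 else v k} := by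
      ext x
      simp only [Set.mem_ofPred_eq, funext_iff (f := φ x)]
      refine forall_congr' fun k => ?_
      by_cases hk : h (ℓ k) = 0 <;> simp [φ, Selected, hk, hmem]
    rw [hset, toOuterMeasure_uniformOfFintype_fiber φ hφ, Fintype.card_fun, Nat.cast_pow,
      ENNReal.inv_pow]
  simp only [hcond]
  rw [ENNReal.tsum_mul_right, PMF.tsum_coe, one_mul]

/-- Two vectors with a common label are both selected only through the second branch. -/
theorem levelWeights_toOuterMeasure_same_label
    (hL : ∀ ℓ ℓ', ℓ ≠ ℓ' → Disjoint (L ℓ) (L ℓ')) {v u : Fin (2 * d) → ZMod 2} (hvu : v ≠ u)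
    {i : Fin n} {ℓ : Fin κ} (hi : i ∈ L ℓ) :
    (levelWeights d n κ L σ).toOuterMeasure
        {W | ∀ k : Fin 2, W (![v, u] k, i) = 2 ^ ((ℓ : ℕ) + 1)}
      = ((Fintype.card (Fin (2 * d) → ZMod 2) : ℝ≥0∞)⁻¹) ^ 2 := by
  classical
  rw [levelWeights_toOuterMeasure hL (Fin 2) ![v, u] (fun _ => i) (fun _ => ℓ)]
  have hcond : ∀ h : Fin κ → (Fin (2 * d) → ZMod 2),
      PMF.uniformOfFintype (Fin κ → (Fin (2 * d) → ZMod 2)) h *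
      (PMF.uniformOfFintype (Matrix (Fin (2 * d)) (Fin d) (ZMod 2) ×
          (Fin n → (Fin (2 * d) → ZMod 2)))).toOuterMeasure
          {x | ∀ k : Fin 2, i ∈ L ℓ ∧ Selected σ h x ℓ (![v, u] k) i}
        = Set.indicator {h | h ℓ = 0} (PMF.uniformOfFintype (Fin κ → (Fin (2 * d) → ZMod 2))) h *
          (Fintype.card (Fin (2 * d) → ZMod 2) : ℝ≥0∞)⁻¹ := by
    intro h
    by_cases hh : h ℓ = 0
    · have hset : {x | ∀ k : Fin 2, i ∈ L ℓ ∧ Selected σ h x ℓ (![v, u] k) i}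
          = {x | ((Pi.evalAddMonoidHom _ i).comp (AddMonoidHom.snd
              (Matrix (Fin (2 * d)) (Fin d) (ZMod 2)) (Fin n → (Fin (2 * d) → ZMod 2)))) x = 0} := by
        ext x
        simp [Selected, hh, hi]
      rw [hset, toOuterMeasure_uniformOfFintype_fiber _
        (fun a => ⟨(0, fun _ => a), rfl⟩), Set.indicator_of_mem (by exact hh)]
    · have hset : {x | ∀ k : Fin 2, i ∈ L ℓ ∧ Selected σ h x ℓ (![v, u] k) i} = ∅ := by
        refine Set.eq_empty_of_forall_notMem fun x hx => hvu ?_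
        obtain ⟨-, hx0⟩ := hx 0
        obtain ⟨-, hx1⟩ := hx 1
        exact (hx0.resolve_right fun hz => hh hz.1).2.symm.trans
          (hx1.resolve_right fun hz => hh hz.1).2
      rw [hset, Set.indicator_of_notMem (by exact hh)]
      simp
  rw [tsum_congr hcond, ENNReal.tsum_mul_right, ← PMF.toOuterMeasure_apply, sq]
  congr 1
  exact toOuterMeasure_uniformOfFintype_fiber (Pi.evalAddMonoidHom (fun _ : Fin κ => Fin (2 * d) → ZMod 2) ℓ)
    (fun a => ⟨fun _ => a, rfl⟩) 0

end LevelWeights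

/-- With `κ ≥ 1` levels, pairwise disjoint label sets `L_ℓ ⊆ [n]` of sizes `n_ℓ`
summing to `n`, and column vectors `σ_i ∈ F_2^d` that are nonzero and pairwise
distinct, the random weights `w` produced by the level construction are pairwise
independent: for distinct labeled vectors `(v,i) ≠ (u,j)` and any levels `ℓ, ℓ'`,
`Pr[w(v,i) = 2^ℓ ∧ w(u,j) = 2^{ℓ'}] = Pr[w(v,i) = 2^ℓ]·Pr[w(u,j) = 2^{ℓ'}]`. -/
theorem stmt14 (κ d : ℕ) (hκ : 1 ≤ κ) (hd : 1 ≤ d)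
    (nl : Fin κ → ℕ) (hnl : ∀ ℓ, 0 < nl ℓ)
    (n : ℕ) (hn : n = ∑ ℓ, nl ℓ)
    (L : Fin κ → Finset (Fin n))
    (hLdisj : ∀ ℓ ℓ', ℓ ≠ ℓ' → Disjoint (L ℓ) (L ℓ'))
    (hLcard : ∀ ℓ, (L ℓ).card = nl ℓ)
    (σ : Fin n → (Fin d → ZMod 2))
    (hσ0 : ∀ i, σ i ≠ 0) (hσinj : Function.Injective σ) :
    ∀ (v u : Fin (2 * d) → ZMod 2) (i j : Fin n), (v, i) ≠ (u, j) →
      ∀ ℓ ℓ' : Fin κ,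
        (levelWeights d n κ L σ).toOuterMeasure
            {W | W (v, i) = 2 ^ ((ℓ : ℕ) + 1) ∧ W (u, j) = 2 ^ ((ℓ' : ℕ) + 1)}
          = (levelWeights d n κ L σ).toOuterMeasure {W | W (v, i) = 2 ^ ((ℓ : ℕ) + 1)}
            * (levelWeights d n κ L σ).toOuterMeasure {W | W (u, j) = 2 ^ ((ℓ' : ℕ) + 1)} := by
  intro v u i j hne ℓ ℓ'
  have hpair : {W : ((Fin (2 * d) → ZMod 2) × Fin n) → ℝ |
        W (v, i) = 2 ^ ((ℓ : ℕ) + 1) ∧ W (u, j) = 2 ^ ((ℓ' : ℕ) + 1)}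
      = {W | ∀ k : Fin 2, W (![v, u] k, ![i, j] k) = 2 ^ ((![ℓ, ℓ'] k : ℕ) + 1)} := by
    ext W
    simp [Fin.forall_fin_two]
  have hone : ∀ (v : Fin (2 * d) → ZMod 2) (i : Fin n) (ℓ : Fin κ),
      {W : ((Fin (2 * d) → ZMod 2) × Fin n) → ℝ | W (v, i) = 2 ^ ((ℓ : ℕ) + 1)}
        = {W | ∀ _ : Unit, W (v, i) = 2 ^ ((ℓ : ℕ) + 1)} := fun v i ℓ => by
    ext W
    simp
  have hnull : ∀ (v : Fin (2 * d) → ZMod 2) (i : Fin n) (ℓ : Fin κ), i ∉ L ℓ →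
      (levelWeights d n κ L σ).toOuterMeasure {W | W (v, i) = 2 ^ ((ℓ : ℕ) + 1)} = 0 :=
    fun v i ℓ hi => by
      rw [hone, levelWeights_toOuterMeasure hLdisj Unit (fun _ => v) (fun _ => i) (fun _ => ℓ)]
      simp [hi]
  have hsingle : ∀ (v : Fin (2 * d) → ZMod 2) (i : Fin n) (ℓ : Fin κ), i ∈ L ℓ →
      (levelWeights d n κ L σ).toOuterMeasure {W | W (v, i) = 2 ^ ((ℓ : ℕ) + 1)}
        = (Fintype.card (Fin (2 * d) → ZMod 2) : ℝ≥0∞)⁻¹ := fun v i ℓ hi => by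
    rw [hone, levelWeights_toOuterMeasure_of_linearIndependent hLdisj (fun _ : Unit => v)
      (fun _ => i) (fun _ => ℓ) (Function.injective_of_subsingleton _)
      (linearIndependent_unique_iff.2 (hσ0 i)) fun _ => hi]
    simp
  by_cases hi : i ∈ L ℓ
  swap
  · rw [hnull v i ℓ hi, zero_mul]
    exact le_antisymm ((MeasureTheory.measure_mono fun W hW => hW.1).trans (hnull v i ℓ hi).le)
      (zero_le)
  by_cases hj : j ∈ L ℓ'
  swap
  · rw [hnull u j ℓ' hj, mul_zero]
    exact le_antisymm ((MeasureTheory.measure_mono fun W hW => hW.2).trans (hnull u j ℓ' hj).le)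
      (zero_le)
  rw [hsingle v i ℓ hi, hsingle u j ℓ' hj, ← sq]
  by_cases hij : i = j
  · subst hij
    have hℓ : ℓ = ℓ' := by
      by_contra h
      exact Finset.disjoint_left.1 (hLdisj ℓ ℓ' h) hi hj
    subst hℓ
    rw [← levelWeights_toOuterMeasure_same_label (σ := σ) hLdisj
      (fun h : v = u => hne (by rw [h])) hi]
    congr 1
    ext W
    simp [Fin.forall_fin_two]
  · rw [hpair, levelWeights_toOuterMeasure_of_linearIndependent hLdisj]
    · simp
    · intro a b
      fin_cases a <;> fin_cases b <;> simp [hij, Ne.symm hij]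
    · have hcomp : σ ∘ ![i, j] = ![σ i, σ j] := by
        funext k
        fin_cases k <;> rfl
      rw [hcomp]
      exact linearIndependent_pair_zmod_two (hσ0 i) (hσ0 j) (hσinj.ne hij)
    · simp [Fin.forall_fin_two, hi, hj]
end

section
/- Let E be a finite set partitioned into nonempty groups P_1, …, P_k, and let μ ∈ [0,1]^E. Let A ⊆ E be a random set whose membership events are pairwise independent with Pr[e ∈ A] = μ_e for all e. Then Σ_{i=1}^k Pr[A ∩ P_i ≠ ∅] ≥ (1/1.299) · Σ_{i=1}^k (1 − ∏_{e∈P_i} (1 − μ_e)). Equivalently, the expected rank of A in the simple partition matroid with parts P_1, …, P_k is at least 1/1.299 times the corresponding expected rank under the product distribution with the same marginals (mutually independent memberships). -/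
open scoped ENNReal
open MeasureTheory

section

open Real

theorem exp_nine_tenths_lt : exp (9 / 10) < 2.4597 := by
  have h : exp (9 / 10) ^ 10 = exp 1 ^ 9 := by
    rw [← exp_nat_mul, ← exp_nat_mul]; norm_num
  have h1 : exp 1 ^ 9 < 2.7182818286 ^ 9 := by
    gcongr; exact exp_one_lt_d9
  refine lt_of_pow_lt_pow_left₀ 10 (by norm_num) ?_
  rw [h]; exact h1.trans (by norm_num)

theorem lt_exp_nine_fifths : 6.0495 < exp (9 / 5) := by
  have h : exp (9 / 5) ^ 5 = exp 1 ^ 9 := by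
    rw [← exp_nat_mul, ← exp_nat_mul]; norm_num
  have h1 : 2.7182818283 ^ 9 < exp 1 ^ 9 := by
    gcongr; exact exp_one_gt_d9
  refine lt_of_pow_lt_pow_left₀ 5 (exp_pos _).le ?_
  rw [h]; exact lt_trans (by norm_num) h1

theorem exp_nine_fifths_lt : exp (9 / 5) < 6.0502 := by
  have h := exp_nine_tenths_lt
  have e : exp (9 / 5) = exp (9 / 10) ^ 2 := by rw [← exp_nat_mul]; norm_num
  rw [e]
  have := exp_pos (9 / 10)
  have : exp (9 / 10) ^ 2 < 2.4597 ^ 2 := by gcongr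
  exact this.trans (by norm_num)

theorem quadratic_le_of_le {w v U : ℝ} (hvU : v ≤ U) (h1 : 4.5588 * w ≤ U + v)
    (h2 : U ^ 2 + 4 * w ^ 2 + 2 * w - 1 ≤ 4.5588 * w * U) :
    v ^ 2 + 4 * w ^ 2 + 2 * w - 1 ≤ 4.5588 * w * v := by
  nlinarith [mul_nonneg (sub_nonneg.2 hvU) (sub_nonneg.2 h1)]

theorem exp_quadratic_bound_of_le {w : ℝ} (h0 : 0 ≤ w) (h1 : w ≤ 0.6) :
    exp w ^ 2 + 4 * w ^ 2 + 2 * w - 1 ≤ 4.5588 * w * exp w := by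
  have hU := exp_bound' h0 (h1.trans (by norm_num)) (n := 4) (by norm_num)
  have hL := quadratic_le_exp_of_nonneg h0
  simp [Finset.sum_range_succ, Nat.factorial] at hU
  refine quadratic_le_of_le hU (by nlinarith [pow_nonneg h0 3, pow_nonneg h0 4]) ?_
  have quartic : 0 ≤ w ^ 4 * (0.0723 - 0.0334 * w - 0.0799 * w ^ 2 - 0.0174 * w ^ 3
      - 0.0028 * w ^ 4) := by
    have : w ^ 2 ≤ 0.6 ^ 2 := by gcongr
    have : w ^ 3 ≤ 0.6 ^ 3 := by gcongr
    have : w ^ 4 ≤ 0.6 ^ 4 := by gcongr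
    exact mul_nonneg (pow_nonneg h0 4) (by linarith)
  have quad : 0 ≤ w * (0.5588 - 1.4412 * w + 0.946 * w ^ 2) :=
    mul_nonneg h0 (by nlinarith [sq_nonneg (w - 0.7617)])
  linarith [pow_nonneg h0 3, pow_nonneg h0 4, pow_nonneg h0 5, pow_nonneg h0 6, pow_nonneg h0 7, pow_nonneg h0 8]

theorem exp_neg_le_quadratic {z : ℝ} (h0 : 0 ≤ z) : exp (-z) ≤ 1 - z + z ^ 2 / 2 := by
  rw [exp_neg]
  refine inv_le_of_inv_le₀ (by nlinarith [sq_nonneg (z-1)]) ?_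
  refine le_trans ?_ (quadratic_le_exp_of_nonneg h0)
  rw [inv_le_iff_one_le_mul₀ (by nlinarith [sq_nonneg (z-1)])]
  nlinarith [pow_nonneg h0 4]

theorem exp_quadratic_bound_near_nine_tenths {z : ℝ} (h0 : 0 ≤ z) (h1 : z ≤ 0.3) :
    exp (9 / 10 - z) ^ 2 + 4 * (9 / 10 - z) ^ 2 + 2 * (9 / 10 - z) - 1 ≤
      4.5588 * (9 / 10 - z) * exp (9 / 10 - z) := by
  have hz : exp (-z) ≤ 1 - z + z ^ 2 / 2 := exp_neg_le_quadratic h0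
  have hU : exp (9 / 10 - z) ≤ 2.4597 * (1 - z + z ^ 2 / 2) := by
    rw [sub_eq_add_neg, exp_add]
    have := exp_nine_tenths_lt.le
    gcongr
  have hL := quadratic_le_exp_of_nonneg (show 0 ≤ 9 / 10 - z by linarith)
  refine quadratic_le_of_le hU (by nlinarith) ?_
  nlinarith [mul_nonneg h0 (sub_nonneg.2 h1), pow_nonneg h0 3, pow_nonneg h0 4]

theorem one_add_mul_exp_sub_one_le {s : ℝ} (h : 9 / 5 ≤ s) : (1 + s) * (exp s - 1) ≤ 1.299 * s * exp s := by
  suffices h : 0 ≤ 0.299 * s - 1 + (1 + s) * exp (-s) by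
    have := mul_nonneg h (exp_pos s).le
    have e : exp (-s) * exp s = 1 := by rw [← exp_add]; simp
    nlinarith
  rcases le_total 3.4 s with h3 | h3
  · have := mul_nonneg (show 0 ≤ 1 + s by linarith) (exp_pos (-s)).le
    linarith
  have e1 : 0.16528 ≤ exp (-(9/5 : ℝ)) := by
    rw [exp_neg]
    refine le_inv_of_le_inv₀ (exp_pos _) (exp_nine_fifths_lt.le.trans (by norm_num))
  have e2 : (1 - (s - 9/5) / 4) ^ 4 ≤ exp (-(s - 9/5)) := by
    have := one_sub_le_exp_neg ((s - 9/5) / 4)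
    calc _ ≤ exp (-((s - 9/5) / 4)) ^ 4 := by gcongr; linarith
      _ = _ := by rw [← exp_nat_mul]; congr 1; push_cast; ring
  have e3 : 0.16528 * (1 - (s - 9/5) / 4) ^ 4 ≤ exp (-s) := by
    have : exp (-s) = exp (-(9/5 : ℝ)) * exp (-(s - 9/5)) := by rw [← exp_add]; ring_nf
    rw [this]; gcongr
  have e4 := mul_le_mul_of_nonneg_left e3 (show 0 ≤ 1 + s by linarith)
  obtain ⟨u, rfl⟩ : ∃ u, s = u + 9/5 := ⟨s - 9/5, by ring⟩
  have hu : 0 ≤ u := by linarith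
  have hu' : u ≤ 1.6 := by linarith
  have : (1 + (u + 9/5)) * (1 - (u + 9 / 5 - 9 / 5) / 4) ^ 4 ≥ 2.8 - 1.8 * u := by
    obtain ⟨a, rfl⟩ : ∃ a, u = 4 - 4 * a := ⟨1 - u / 4, by ring⟩
    have ha : 0 ≤ a := by linarith
    have ha' : a ≤ 1 := by linarith
    have : a ^ 2 ≤ a := by nlinarith
    have : a ^ 3 ≤ a := by nlinarith
    nlinarith [mul_nonneg (sq_nonneg (1 - a))
      (show 0 ≤ 4.4 + 1.6 * a - 1.2 * a ^ 2 - 4 * a ^ 3 by linarith)]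
  linarith

theorem sq_add_self_le_exp {s : ℝ} (h : 9 / 5 ≤ s) : s ^ 2 + s + 1 ≤ exp s := by
  have h1 := quadratic_le_exp_of_nonneg (show 0 ≤ s - 9/5 by linarith)
  have : exp s = exp (9/5) * exp (s - 9/5) := by rw [← exp_add]; ring_nf
  have h2 := lt_exp_nine_fifths.le
  have h3 : 6.0495 * (1 + (s - 9/5) + (s-9/5)^2/2) ≤ exp s := by rw [this]; gcongr
  nlinarith

theorem sq_exp_bound_of_le {s : ℝ} (h0 : 0 ≤ s) (h : s ≤ 9 / 5) :
    (s ^ 2 + s + exp s - 1) ^ 2 ≤ 4 * (1.299 * s ^ 2 * exp s) := by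
  obtain ⟨w, rfl⟩ : ∃ w, s = 2 * w := ⟨s / 2, by ring⟩
  have hw : exp w ^ 2 + 4 * w ^ 2 + 2 * w - 1 ≤ 4.5588 * w * exp w := by
    rcases le_total w 0.6 with h1 | h1
    · exact exp_quadratic_bound_of_le (by linarith) h1
    · have := exp_quadratic_bound_near_nine_tenths (z := 9 / 10 - w) (by linarith) (by linarith)
      simpa using this
  have e : exp (2 * w) = exp w ^ 2 := by rw [← exp_nat_mul]; norm_num
  rw [e]
  have h2 : 1 ≤ exp w := one_le_exp (by linarith)
  have h3 : (exp w ^ 2 + 4 * w ^ 2 + 2 * w - 1) ^ 2 ≤ (4.5588 * w * exp w) ^ 2 := by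
    have : 0 ≤ w := by linarith
    refine pow_le_pow_left₀ ?_ hw 2
    nlinarith
  nlinarith [sq_nonneg (w * exp w)]

theorem one_sub_exp_neg_mul_le_s15 {s q : ℝ} (h0 : 0 < s) (hq : 0 ≤ q) :
    (1 - exp (-s) * (1 - q)) * (s + s ^ 2 - q) ≤ 1.299 * s ^ 2 := by
  suffices h : (exp s - (1 - q)) * (s + s ^ 2 - q) ≤ 1.299 * s ^ 2 * exp s by
    have e : exp (-s) * exp s = 1 := by rw [← exp_add]; simp
    have := mul_le_mul_of_nonneg_left h (exp_pos (-s)).le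
    linear_combination this + ((1.299 * s ^ 2) - (s + s ^ 2 - q)) * e
  rcases le_total s (9 / 5) with h | h
  · nlinarith [sq_exp_bound_of_le h0.le h, sq_nonneg (2 * q - (s + s ^ 2 - (exp s - 1)))]
  · have h1 := sq_add_self_le_exp h
    have h2 := mul_le_mul_of_nonneg_left (one_add_mul_exp_sub_one_le h) h0.le
    nlinarith [mul_nonneg hq (sub_nonneg.2 h1), sq_nonneg q]

theorem one_sub_sum_le_prod {E : Type*} (S : Finset E) (x : E → ℝ)
    (h0 : ∀ e ∈ S, 0 ≤ x e) (h1 : ∀ e ∈ S, x e ≤ 1) :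
    1 - ∑ e ∈ S, x e ≤ ∏ e ∈ S, (1 - x e) := by
  classical
  induction S using Finset.induction_on with
  | empty => simp
  | insert a S ha ih =>
    rw [Finset.sum_insert ha, Finset.prod_insert ha]
    have := ih (fun e he => h0 e (by simp [he])) (fun e he => h1 e (by simp [he]))
    have p : ∏ e ∈ S, (1 - x e) ≤ 1 := Finset.prod_le_one
      (fun e he => by linarith [h1 e (by simp [he])]) (fun e he => by linarith [h0 e (by simp [he])])
    nlinarith [h0 a (by simp), mul_nonneg (h0 a (by simp)) (sub_nonneg.2 p)]

theorem exp_neg_mul_le_prod {E : Type*} (S : Finset E) (p : E → ℝ)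
    (h0 : ∀ e ∈ S, 0 ≤ p e) (h1 : ∀ e ∈ S, p e ≤ 1) :
    exp (-∑ e ∈ S, p e) * (1 - ∑ e ∈ S, p e ^ 2) ≤ ∏ e ∈ S, (1 - p e) := by
  have h := one_sub_sum_le_prod S (fun e => p e ^ 2) (fun e _ => sq_nonneg _)
    (fun e he => pow_le_one₀ (h0 e he) (h1 e he))
  calc _ ≤ exp (-∑ e ∈ S, p e) * ∏ e ∈ S, (1 - p e ^ 2) := by gcongr
    _ = ∏ e ∈ S, (exp (-p e) * (1 - p e ^ 2)) := by
      rw [Finset.prod_mul_distrib, ← exp_sum, Finset.sum_neg_distrib]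
    _ ≤ _ := by
      refine Finset.prod_le_prod (fun e he => ?_) (fun e he => ?_)
      · exact mul_nonneg (exp_pos _).le (by nlinarith [h0 e he, h1 e he])
      · have a : exp (-p e) * (1 + p e) ≤ 1 := by
          rw [exp_neg, inv_mul_le_iff₀ (exp_pos _)]
          linarith [add_one_le_exp (p e)]
        nlinarith [mul_nonneg (sub_nonneg.2 a) (sub_nonneg.2 (h1 e he))]

theorem second_moment_le_measure_biUnion {Ω E : Type*} [MeasurableSpace Ω] (μ : Measure Ω) [IsProbabilityMeasure μ]
    (S : Finset E) (B : E → Set Ω) (hB : ∀ e ∈ S, MeasurableSet (B e))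
    (hpw : ∀ e ∈ S, ∀ f ∈ S, e ≠ f → μ.real (B e ∩ B f) = μ.real (B e) * μ.real (B f)) (t : ℝ) :
    2 * t * ∑ e ∈ S, μ.real (B e) -
        t ^ 2 * (∑ e ∈ S, μ.real (B e) + (∑ e ∈ S, μ.real (B e)) ^ 2
          - ∑ e ∈ S, μ.real (B e) ^ 2) ≤
      μ.real (⋃ e ∈ S, B e) := by
  classical
  set X : Ω → ℝ := fun ω => ∑ e ∈ S, (B e).indicator 1 ω with hX
  have hU : MeasurableSet (⋃ e ∈ S, B e) := S.measurableSet_biUnion hB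
  have int (C : Set Ω) (hC : MeasurableSet C) : Integrable (C.indicator (1 : Ω → ℝ)) μ :=
    (integrable_const (1 : ℝ)).indicator hC
  have hXX : (fun ω => X ω ^ 2) = fun ω => ∑ e ∈ S, ∑ f ∈ S, (B e ∩ B f).indicator 1 ω := by
    ext ω
    simp only [hX, sq, Finset.sum_mul_sum, Set.inter_indicator_one, Pi.mul_apply]
  have i1 : Integrable X μ := integrable_finsetSum _ fun e he => int _ (hB e he)
  have i2 : Integrable (fun ω => X ω ^ 2) μ := by
    rw [hXX]
    exact integrable_finsetSum _ fun e he => integrable_finsetSum _ fun f hf =>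
      int _ ((hB e he).inter (hB f hf))
  have m1 : ∫ ω, X ω ∂μ = ∑ e ∈ S, μ.real (B e) := by
    rw [integral_finsetSum _ fun e he => int _ (hB e he)]
    exact Finset.sum_congr rfl fun e he => integral_indicator_one (hB e he)
  have m2 : ∫ ω, X ω ^ 2 ∂μ = ∑ e ∈ S, μ.real (B e) + (∑ e ∈ S, μ.real (B e)) ^ 2
      - ∑ e ∈ S, μ.real (B e) ^ 2 := by
    rw [hXX, integral_finsetSum _ fun e he => integrable_finsetSum _ fun f hf =>
      int _ ((hB e he).inter (hB f hf)), sq (∑ e ∈ S, μ.real (B e)), Finset.sum_mul_sum,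
      ← Finset.sum_add_distrib, ← Finset.sum_sub_distrib]
    refine Finset.sum_congr rfl fun e he => ?_
    rw [integral_finsetSum _ fun f hf => int _ ((hB e he).inter (hB f hf)),
      ← Finset.add_sum_erase _ _ he, ← Finset.add_sum_erase _ (fun f => μ.real (B e) * _) he,
      integral_indicator_one ((hB e he).inter (hB e he)), Set.inter_self,
      Finset.sum_congr rfl (g := fun f => μ.real (B e) * μ.real (B f))]
    · ring
    · intro f hf
      rw [Finset.mem_erase] at hf
      rw [integral_indicator_one ((hB e he).inter (hB f hf.2)), hpw e he f hf.2 hf.1.symm]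
  rw [← m2, ← m1, ← integral_const_mul, ← integral_const_mul,
    ← integral_sub (i1.const_mul _) (i2.const_mul _), ← integral_indicator_one hU]
  refine integral_mono ((i1.const_mul _).sub (i2.const_mul _)) (int _ hU) fun ω => ?_
  by_cases hω : ω ∈ ⋃ e ∈ S, B e
  · simp only [Set.indicator_of_mem hω, Pi.one_apply]
    nlinarith [sq_nonneg (1 - t * X ω)]
  · have : X ω = 0 := Finset.sum_eq_zero fun e he =>
      Set.indicator_of_notMem (fun h => hω (Set.mem_biUnion he h)) _
    simp [this, Set.indicator_of_notMem hω]

theorem one_sub_prod_le_measureReal_biUnion {Ω E : Type*} [MeasurableSpace Ω] (μ : Measure Ω) [IsProbabilityMeasure μ]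
    (S : Finset E) (B : E → Set Ω) (hB : ∀ e ∈ S, MeasurableSet (B e))
    (hpw : ∀ e ∈ S, ∀ f ∈ S, e ≠ f → μ.real (B e ∩ B f) = μ.real (B e) * μ.real (B f)) :
    1 - ∏ e ∈ S, (1 - μ.real (B e)) ≤ 1.299 * μ.real (⋃ e ∈ S, B e) := by
  have h0 (e) (_ : e ∈ S) : 0 ≤ μ.real (B e) := measureReal_nonneg
  have h1 (e) (_ : e ∈ S) : μ.real (B e) ≤ 1 := measureReal_le_one
  have hb := second_moment_le_measure_biUnion μ S B hB hpw
  have hp := exp_neg_mul_le_prod S (fun e => μ.real (B e)) h0 h1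
  have hq : ∑ e ∈ S, μ.real (B e) ^ 2 ≤ ∑ e ∈ S, μ.real (B e) :=
    Finset.sum_le_sum fun e he => by nlinarith [h0 e he, h1 e he]
  have hq0 : 0 ≤ ∑ e ∈ S, μ.real (B e) ^ 2 := Finset.sum_nonneg fun e _ => sq_nonneg _
  set s := ∑ e ∈ S, μ.real (B e)
  set q := ∑ e ∈ S, μ.real (B e) ^ 2
  rcases (Finset.sum_nonneg h0).eq_or_lt with hs | hs
  · change 0 = s at hs
    have : q = 0 := by linarith
    rw [this, ← hs] at hp
    have : 0 ≤ μ.real (⋃ e ∈ S, B e) := measureReal_nonneg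
    simp at hp
    linarith
  · change 0 < s at hs
    have hM : 0 < s + s ^ 2 - q := by nlinarith
    have hb' := hb (s / (s + s ^ 2 - q))
    have hm := one_sub_exp_neg_mul_le_s15 hs hq0
    have : s ^ 2 / (s + s ^ 2 - q) ≤ μ.real (⋃ e ∈ S, B e) := by
      refine le_trans (le_of_eq ?_) hb'
      field_simp
      ring
    calc _ ≤ 1 - exp (-s) * (1 - q) := by linarith
      _ ≤ 1.299 * s ^ 2 / (s + s ^ 2 - q) := by rwa [le_div_iff₀ hM]
      _ ≤ _ := by rw [mul_div_assoc]; gcongr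

theorem one_sub_prod_le_measure_biUnion {Ω E : Type*} [MeasurableSpace Ω] (μ : Measure Ω) [IsProbabilityMeasure μ]
    (S : Finset E) (B : E → Set Ω) (hB : ∀ e ∈ S, MeasurableSet (B e))
    (hpw : ∀ e ∈ S, ∀ f ∈ S, e ≠ f → μ (B e ∩ B f) = μ (B e) * μ (B f)) :
    (1000 / 1299 : ENNReal) * (1 - ∏ e ∈ S, (1 - μ (B e))) ≤ μ (⋃ e ∈ S, B e) := by
  have h := one_sub_prod_le_measureReal_biUnion μ S B hB fun e he f hf hef => by
    simp only [measureReal_def, hpw e he f hf hef, ENNReal.toReal_mul]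
  have hp : ∏ e ∈ S, (1 - μ (B e)) ≤ 1 := Finset.prod_le_one' fun e _ => tsub_le_self
  have hc : (1000 / 1299 : ENNReal) ≠ ⊤ := ENNReal.div_ne_top (by norm_num) (by norm_num)
  rw [← ENNReal.toReal_le_toReal (ENNReal.mul_ne_top hc (ne_top_of_le_ne_top ENNReal.one_ne_top
      tsub_le_self)) (measure_ne_top _ _), ENNReal.toReal_mul,
    ENNReal.toReal_sub_of_le hp ENNReal.one_ne_top, ENNReal.toReal_prod]
  simp only [ENNReal.toReal_sub_of_le prob_le_one ENNReal.one_ne_top, ENNReal.toReal_div,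
    ENNReal.toReal_ofNat, ENNReal.toReal_one, ← measureReal_def]
  linarith

end

/-- Let `E` be partitioned into nonempty groups `P_1, …, P_k` and let `A` be a random
set with pairwise independent membership events and marginals `μ_e ∈ [0,1]`. Then
`∑_i Pr[A ∩ P_i ≠ ∅] ≥ (1/1.299)·∑_i (1 − ∏_{e∈P_i}(1 − μ_e))`: the expected rank of
`A` in the simple partition matroid with parts `P_1, …, P_k` is at least `1/1.299`
times the corresponding expected rank under mutually independent memberships with
the same marginals. -/
theorem stmt15 {Ω E : Type*} [MeasurableSpace Ω] [Fintype E]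
    (μ : Measure Ω) [IsProbabilityMeasure μ]
    (k : ℕ) (P : Fin k → Finset E)
    (hPne : ∀ i, (P i).Nonempty)
    (hPdisj : ∀ i j, i ≠ j → Disjoint (P i) (P j))
    (hPcover : ∀ e : E, ∃ i, e ∈ P i)
    (marg : E → ℝ≥0∞) (hmarg1 : ∀ e, marg e ≤ 1)
    (A : Ω → Set E) (hmeas : ∀ e, MeasurableSet {ω | e ∈ A ω})
    (hAmarg : ∀ e, μ {ω | e ∈ A ω} = marg e)
    (hpw : ∀ e f : E, e ≠ f →
      μ ({ω | e ∈ A ω} ∩ {ω | f ∈ A ω}) = μ {ω | e ∈ A ω} * μ {ω | f ∈ A ω}) :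
    (1000 / 1299 : ℝ≥0∞) * ∑ i : Fin k, (1 - ∏ e ∈ P i, (1 - marg e))
      ≤ ∑ i : Fin k, μ {ω | ∃ e ∈ P i, e ∈ A ω} := by
  rw [Finset.mul_sum]
  refine Finset.sum_le_sum fun i _ => ?_
  have h := one_sub_prod_le_measure_biUnion μ (P i) (fun e => {ω | e ∈ A ω})
    (fun e _ => hmeas e) (fun e _ f _ hef => hpw e f hef)
  have hU : {ω | ∃ e ∈ P i, e ∈ A ω} = ⋃ e ∈ P i, {ω | e ∈ A ω} := by
    ext ω; simp
  simpa only [hU, hAmarg] using h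
end

section
/- Let M = (E, I) be a finite matroid satisfying the α-partition property for some α ∈ (0, 1]. Then for every μ in the matroid polytope of M, every random set A ⊆ E whose membership events are pairwise independent with Pr[e ∈ A] = μ_e, and every F ⊆ E: E[rank_M(A ∩ F)] ≥ (1/1.299) · (1 − 1/e) · α · Σ_{e∈F} μ_e. (By the characterization of distributions admitting contention resolution, this means every such pairwise-independent distribution admits a ((1−1/e)/1.299)·α-balanced offline contention resolution scheme.) -/
open scoped ENNReal
open MeasureTheory

/-- A simple partition datum for an independence system `Indep` on a finite ground
type: a finite family of pairwise disjoint nonempty parts such that every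
transversal (a set contained in the union of the parts meeting each part at most
once) is independent. -/
def IsPartitionDatum {γ : Type*} [DecidableEq γ] (Indep : Finset γ → Prop)
    (P : Finset (Finset γ)) : Prop :=
  (∀ p ∈ P, p.Nonempty) ∧
  (∀ p ∈ P, ∀ q ∈ P, p ≠ q → Disjoint p q) ∧
  (∀ T : Finset γ, (∀ x ∈ T, ∃ p ∈ P, x ∈ p) → (∀ p ∈ P, (T ∩ p).card ≤ 1) → Indep T)

/-- The weighted rank of a simple partition datum: the sum over parts of the maximum
weight in the part. -/
noncomputable def partitionWRank {γ : Type*} (P : Finset (Finset γ)) (w : γ → ℝ) : ℝ :=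
  ∑ p ∈ P, sSup (w '' ↑p)

/-- The weighted rank `Rank_w = max{∑_{e∈T} w e : T independent}` of an independence
system. -/
noncomputable def maxIndepWeight {γ : Type*} (Indep : Finset γ → Prop) (w : γ → ℝ) : ℝ :=
  sSup {x : ℝ | ∃ T : Finset γ, Indep T ∧ ∑ e ∈ T, w e = x}

/-- The `α`-partition property: there is a probability distribution over simple
partition data whose expected weighted rank is at least `α` times the weighted rank,
for every nonnegative weight function. -/
def HasPartitionProperty {γ : Type*} [DecidableEq γ] (Indep : Finset γ → Prop)
    (α : ℝ) : Prop :=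
  ∃ D : PMF {P : Finset (Finset γ) // IsPartitionDatum Indep P},
    ∀ w : γ → ℝ, (∀ e, 0 ≤ w e) →
      ENNReal.ofReal (α * maxIndepWeight Indep w)
        ≤ ∑' P, D P * ENNReal.ofReal (partitionWRank (↑P) w)

/-- The rank of a set `S` in a matroid `M`: the largest cardinality of an independent
subset of `S`. -/
noncomputable def mrank {α : Type*} (M : Matroid α) (S : Set α) : ℕ :=
  sSup {n | ∃ T : Finset α, ↑T ⊆ S ∧ M.Indep ↑T ∧ T.card = n}

section Rank

variable {E : Type*} [Fintype E]

theorem card_le_mrank (M : Matroid E) {S : Set E} {T : Finset E} (hTS : ↑T ⊆ S)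
    (hT : M.Indep ↑T) : T.card ≤ mrank M S := by
  refine le_csSup ⟨Fintype.card E, ?_⟩ ⟨T, hTS, hT, rfl⟩
  rintro n ⟨U, -, -, rfl⟩
  exact U.card_le_univ

theorem exists_indep_card_eq_mrank (M : Matroid E) (S : Set E) :
    ∃ T : Finset E, ↑T ⊆ S ∧ M.Indep ↑T ∧ T.card = mrank M S := by
  refine Nat.sSup_mem (s := {n | ∃ T : Finset E, ↑T ⊆ S ∧ M.Indep ↑T ∧ T.card = n})
    ⟨0, ∅, by simp, by simp, rfl⟩ ⟨Fintype.card E, ?_⟩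
  rintro n ⟨U, -, -, rfl⟩
  exact U.card_le_univ

theorem exists_indep_superset_card_ge_mrank [DecidableEq E] (M : Matroid E)
    (hME : M.E = Set.univ) {S T : Finset E} (hTS : T ⊆ S) (hT : M.Indep ↑T) :
    ∃ U : Finset E, T ⊆ U ∧ U ⊆ S ∧ M.Indep ↑U ∧ mrank M ↑S ≤ U.card := by
  obtain ⟨B, hB, hTB⟩ := hT.subset_isBasis_of_subset (X := (↑S : Set E))
    (by exact_mod_cast hTS) (by simp [hME])
  lift B to Finset E using B.toFinite
  refine ⟨B, by exact_mod_cast hTB, by exact_mod_cast hB.subset, hB.indep, ?_⟩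
  obtain ⟨V, hVS, hV, hVc⟩ := exists_indep_card_eq_mrank M ↑S
  have h := hV.encard_le_eRk_of_subset hVS
  rw [← hB.encard_eq_eRk, Set.encard_coe_eq_coe_finsetCard, Set.encard_coe_eq_coe_finsetCard] at h
  rw [← hVc]
  exact_mod_cast h

/-- A nonnegative linear objective is maximized over the matroid polytope at an
independent set. -/
theorem exists_indep_sum_mul_le [DecidableEq E] (M : Matroid E) (hME : M.E = Set.univ)
    (x : E → ℝ) (hx : ∀ S : Finset E, ∑ e ∈ S, x e ≤ (mrank M ↑S : ℝ))
    (w : E → ℝ) (hw : ∀ e, 0 ≤ w e) :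
    ∃ T : Finset E, M.Indep ↑T ∧ ∑ e, w e * x e ≤ ∑ e ∈ T, w e := by
  classical
  induction h : (Finset.univ.filter fun e => 0 < w e).card using Nat.strong_induction_on
    generalizing w with
  | _ n ih =>
    set S := Finset.univ.filter fun e => 0 < w e with hS
    have hoff : ∀ e, e ∉ S → w e = 0 := fun e he =>
      le_antisymm (by simpa [hS] using he) (hw e)
    rcases S.eq_empty_or_nonempty with hempty | hne
    · refine ⟨∅, by simp, ?_⟩
      simp [hoff, hempty]
    obtain ⟨a, haS, ha⟩ := S.exists_min_image w hne
    let w' : E → ℝ := fun e => if e ∈ S then w e - w a else 0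
    have hw' : ∀ e, 0 ≤ w' e := fun e => by
      by_cases he : e ∈ S
      · simpa [w', he] using ha e he
      · simp [w', he]
    have hlt : (Finset.univ.filter fun e => 0 < w' e).card < n := by
      rw [← h]
      refine Finset.card_lt_card ⟨fun e he => ?_, fun hsub => ?_⟩
      · by_contra hc
        simp [w', hc] at he
      · have := hsub haS
        simp [w', haS] at this
    obtain ⟨T', hT', hle⟩ := ih _ hlt w' hw' rfl
    obtain ⟨T, hTT, hTS, hT, hcard⟩ := exists_indep_superset_card_ge_mrank M hME
      (Finset.inter_subset_right : T' ∩ S ⊆ S)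
      (hT'.subset (by exact_mod_cast Finset.inter_subset_left))
    refine ⟨T, hT, ?_⟩
    have ha0 : 0 ≤ w a := hw a
    have hsplit : ∑ e, w e * x e = w a * ∑ e ∈ S, x e + ∑ e, w' e * x e := by
      have hwa : w a * ∑ e ∈ S, x e = ∑ e, if e ∈ S then w a * x e else 0 := by
        rw [Finset.mul_sum, Finset.sum_ite_mem, Finset.univ_inter]
      rw [hwa, ← Finset.sum_add_distrib]
      refine Finset.sum_congr rfl fun e _ => ?_
      by_cases he : e ∈ S
      · simp only [w', if_pos he]
        ring
      · simp [w', he, hoff e he]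
    have hT'w : ∑ e ∈ T', w' e ≤ ∑ e ∈ T, w' e := by
      calc ∑ e ∈ T', w' e = ∑ e ∈ T' ∩ S, w' e := by
            refine (Finset.sum_subset Finset.inter_subset_left fun e he hn => ?_).symm
            have : e ∉ S := fun hs => hn (Finset.mem_inter.2 ⟨he, hs⟩)
            simp [w', this]
        _ ≤ _ := Finset.sum_le_sum_of_subset_of_nonneg hTT fun e _ _ => hw' e
    have hTw : ∑ e ∈ T, w e = w a * T.card + ∑ e ∈ T, w' e := by
      rw [mul_comm, ← nsmul_eq_mul, ← Finset.sum_const, ← Finset.sum_add_distrib]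
      exact Finset.sum_congr rfl fun e he => by simp [w', hTS he]
    have hr : ∑ e ∈ S, x e ≤ T.card := (hx S).trans (by exact_mod_cast hcard)
    rw [hsplit, hTw]
    linarith [mul_le_mul_of_nonneg_left hr ha0]

/-- Edmonds: the matroid polytope is the convex hull of the indicator vectors of
the independent sets. -/
theorem mem_convexHull_indicator_indep [DecidableEq E] (M : Matroid E)
    (hME : M.E = Set.univ) (x : E → ℝ) (hx0 : ∀ e, 0 ≤ x e)
    (hx : ∀ S : Finset E, ∑ e ∈ S, x e ≤ (mrank M ↑S : ℝ)) :
    x ∈ convexHull ℝ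
      {y : E → ℝ | ∃ T : Finset E, M.Indep ↑T ∧ y = fun e => if e ∈ T then 1 else 0} := by
  classical
  set V := {y : E → ℝ | ∃ T : Finset E, M.Indep ↑T ∧ y = fun e => if e ∈ T then 1 else 0}
    with hV
  have hfin : V.Finite :=
    (Set.finite_range fun T : Finset E => fun e => if e ∈ T then (1 : ℝ) else 0).subset <| by
      rintro _ ⟨T, -, rfl⟩
      exact ⟨T, rfl⟩
  by_contra hxV
  obtain ⟨f, u, hlt, hu⟩ := geometric_hahn_banach_closed_point (convex_convexHull ℝ V)
    (hfin.isCompact_convexHull ℝ).isClosed hxV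
  have hf : ∀ y : E → ℝ, f y = ∑ e, f (Pi.single e 1) * y e := fun y => by
    conv_lhs => rw [pi_eq_sum_univ' y]
    simp only [map_sum, map_smul, smul_eq_mul, mul_comm]
  obtain ⟨T, hT, hle⟩ := exists_indep_sum_mul_le M hME x hx
    (fun e => max (f (Pi.single e 1)) 0) fun e => le_max_right _ _
  set T₁ := T.filter fun e => 0 < f (Pi.single e 1) with hT₁
  have hT₁i : M.Indep ↑T₁ := hT.subset (by exact_mod_cast Finset.filter_subset _ _)
  have h1 := hlt _ (subset_convexHull ℝ V ⟨T₁, hT₁i, rfl⟩)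
  have h2 : f (fun e => if e ∈ T₁ then 1 else 0) = ∑ e ∈ T, max (f (Pi.single e 1)) 0 := by
    rw [hf]
    simp only [mul_ite, mul_one, mul_zero, Finset.sum_ite_mem, Finset.univ_inter]
    rw [hT₁, Finset.sum_filter]
    refine Finset.sum_congr rfl fun e _ => ?_
    split_ifs with h
    · exact (max_eq_left h.le).symm
    · exact (max_eq_right (not_lt.1 h)).symm
  have h3 : f x ≤ ∑ e, max (f (Pi.single e 1)) 0 * x e := by
    rw [hf]
    exact Finset.sum_le_sum fun e _ => mul_le_mul_of_nonneg_right (le_max_left _ _) (hx0 e)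
  linarith

open Classical in
/-- The number of parts meeting `S` is at most the rank of `S`. -/
theorem card_filter_inter_nonempty_le_mrank [DecidableEq E] (M : Matroid E)
    {P : Finset (Finset E)} (hP : IsPartitionDatum (fun T : Finset E => M.Indep ↑T) P)
    (S : Set E) :
    (P.filter fun p => ∃ e ∈ p, e ∈ S).card ≤ mrank M S := by
  obtain ⟨-, hdisj, hind⟩ := hP
  set Q := P.filter fun p => ∃ e ∈ p, e ∈ S with hQ
  have hex : ∀ p : Q, ∃ a, a ∈ p.1 ∧ a ∈ S := fun p => (Finset.mem_filter.1 p.2).2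
  choose g hgp hgS using hex
  have huniq : ∀ p q : Finset E, p ∈ P → q ∈ P → ∀ e, e ∈ p → e ∈ q → p = q :=
    fun p q hp hq e hep heq => by
      by_contra hne
      exact Finset.disjoint_left.1 (hdisj p hp q hq hne) hep heq
  have hQP : ∀ p : Q, p.1 ∈ P := fun p => (Finset.mem_filter.1 p.2).1
  have hginj : Function.Injective g := fun p q h =>
    Subtype.ext (huniq _ _ (hQP p) (hQP q) (g p) (hgp p) (h ▸ hgp q))
  have hcard : (Finset.univ.image g).card = Q.card := by
    rw [Finset.card_image_of_injective _ hginj]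
    simp
  rw [← hcard]
  refine card_le_mrank M ?_ (hind _ ?_ ?_)
  · intro e he
    obtain ⟨p, -, rfl⟩ := Finset.mem_image.1 (Finset.mem_coe.1 he)
    exact hgS p
  · intro e he
    obtain ⟨p, -, rfl⟩ := Finset.mem_image.1 he
    exact ⟨p.1, hQP p, hgp p⟩
  · intro p hp
    refine Finset.card_le_one.2 fun a ha b hb => ?_
    obtain ⟨ha, hap⟩ := Finset.mem_inter.1 ha
    obtain ⟨hb, hbp⟩ := Finset.mem_inter.1 hb
    obtain ⟨q, -, rfl⟩ := Finset.mem_image.1 ha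
    obtain ⟨r, -, rfl⟩ := Finset.mem_image.1 hb
    have h1 := huniq _ _ (hQP q) hp _ (hgp q) hap
    have h2 := huniq _ _ (hQP r) hp _ (hgp r) hbp
    rw [Subtype.ext (h1.trans h2.symm)]

end Rank

section PartitionProperty

theorem card_le_maxIndepWeight_indicator {E : Type*} [Fintype E] [DecidableEq E]
    (M : Matroid E) {T : Finset E} (hT : M.Indep ↑T) (F : Finset E) :
    ((T ∩ F).card : ℝ) ≤ maxIndepWeight (fun T : Finset E => M.Indep ↑T)
      (fun e => if e ∈ T ∩ F then 1 else 0) := by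
  refine le_csSup (Set.Finite.bddAbove ?_) ⟨T, hT, ?_⟩
  · refine (Set.finite_range fun U : Finset E =>
      ∑ e ∈ U, if e ∈ T ∩ F then (1 : ℝ) else 0).subset ?_
    rintro _ ⟨U, -, rfl⟩
    exact ⟨U, rfl⟩
  · rw [Finset.sum_ite_mem, ← Finset.inter_assoc, Finset.inter_self]
    simp

theorem partitionWRank_indicator_le {E : Type*} [DecidableEq E]
    {P : Finset (Finset E)} (hP : ∀ p ∈ P, p.Nonempty)
    (S : Finset E) :
    partitionWRank P (fun e => if e ∈ S then 1 else 0)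
      ≤ ∑ p ∈ P, min 1 (∑ e ∈ p, if e ∈ S then (1 : ℝ) else 0) := by
  refine Finset.sum_le_sum fun p hp => csSup_le ?_ ?_
  · exact (Finset.coe_nonempty.2 (hP p hp)).image _
  · rintro _ ⟨e, he, rfl⟩
    refine le_min (by dsimp only; split_ifs <;> norm_num) ?_
    exact Finset.single_le_sum (f := fun e => if e ∈ S then (1 : ℝ) else 0)
      (fun i _ => by split_ifs <;> norm_num) he

theorem partitionWRank_nonneg {E : Type*} (P : Finset (Finset E)) {w : E → ℝ}
    (hw : ∀ e, 0 ≤ w e) :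
    0 ≤ partitionWRank P w := by
  refine Finset.sum_nonneg fun p _ => Real.sSup_nonneg ?_
  rintro _ ⟨e, -, rfl⟩
  exact hw e

/-- The `α`-partition property, extended from independent sets to fractional points of the
matroid polytope. -/
theorem HasPartitionProperty.exists_weights {E : Type*} [Fintype E] [DecidableEq E]
    {M : Matroid E} (hME : M.E = Set.univ) {α : ℝ}
    (hα : 0 ≤ α) (hpart : HasPartitionProperty (fun T : Finset E => M.Indep ↑T) α) :
    ∃ d : {P : Finset (Finset E) // IsPartitionDatum (fun T : Finset E => M.Indep ↑T) P} → ℝ,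
      (∀ P, 0 ≤ d P) ∧ (∑ᶠ P, d P = 1) ∧
      ∀ x : E → ℝ, (∀ e, 0 ≤ x e) →
        (∀ S : Finset E, ∑ e ∈ S, x e ≤ (mrank M ↑S : ℝ)) → ∀ F : Finset E,
        α * ∑ e ∈ F, x e ≤ ∑ᶠ P, d P * ∑ p ∈ P.1, min 1 (∑ e ∈ p ∩ F, x e) := by
  classical
  obtain ⟨D, hD⟩ := hpart
  have hne : ∀ P, D P ≠ ∞ := D.apply_ne_top
  refine ⟨fun P => (D P).toReal, fun P => ENNReal.toReal_nonneg, ?_, ?_⟩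
  · rw [finsum_eq_sum_of_fintype, ← ENNReal.toReal_sum fun P _ => hne P,
      ← tsum_fintype (L := .unconditional _), D.tsum_coe, ENNReal.toReal_one]
  intro x hx0 hx F
  rw [finsum_eq_sum_of_fintype]
  set C : Set (E → ℝ) := {x | α * ∑ e ∈ F, x e ≤
    ∑ P : {P : Finset (Finset E) // IsPartitionDatum (fun T : Finset E => M.Indep ↑T) P},
      (D P).toReal * ∑ p ∈ P.1, min 1 (∑ e ∈ p ∩ F, x e)} with hC
  suffices h : x ∈ C from h
  have hconv : Convex ℝ C := by
    intro y hy z hz a b ha hb hab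
    simp only [hC, Set.mem_ofPred_eq] at hy hz ⊢
    have hsum : ∀ S : Finset E,
        ∑ e ∈ S, (a • y + b • z) e = a * ∑ e ∈ S, y e + b * ∑ e ∈ S, z e := fun S => by
      simp [Finset.sum_add_distrib, Finset.mul_sum]
    simp only [hsum]
    calc α * (a * ∑ e ∈ F, y e + b * ∑ e ∈ F, z e)
        = a * (α * ∑ e ∈ F, y e) + b * (α * ∑ e ∈ F, z e) := by ring
      _ ≤ _ := add_le_add (mul_le_mul_of_nonneg_left hy ha) (mul_le_mul_of_nonneg_left hz hb)
      _ ≤ _ := by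
        rw [Finset.mul_sum, Finset.mul_sum, ← Finset.sum_add_distrib]
        refine Finset.sum_le_sum fun P _ => ?_
        rw [mul_left_comm, mul_left_comm b, ← mul_add]
        refine mul_le_mul_of_nonneg_left ?_ ENNReal.toReal_nonneg
        rw [Finset.mul_sum, Finset.mul_sum, ← Finset.sum_add_distrib]
        refine Finset.sum_le_sum fun p _ => le_min ?_ ?_
        · have h1 := mul_le_mul_of_nonneg_left (min_le_left 1 (∑ e ∈ p ∩ F, y e)) ha
          have h2 := mul_le_mul_of_nonneg_left (min_le_left 1 (∑ e ∈ p ∩ F, z e)) hb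
          linarith
        · exact add_le_add (mul_le_mul_of_nonneg_left (min_le_right _ _) ha)
            (mul_le_mul_of_nonneg_left (min_le_right _ _) hb)
  refine convexHull_min ?_ hconv (mem_convexHull_indicator_indep M hME x hx0 hx)
  rintro _ ⟨T, hT, rfl⟩
  simp only [hC, Set.mem_ofPred_eq]
  set w : E → ℝ := fun e => if e ∈ T ∩ F then 1 else 0 with hw
  have hw0 : ∀ e, 0 ≤ w e := fun e => by simp only [hw]; split_ifs <;> norm_num
  have hinter : ∀ S : Finset E,
      ∑ e ∈ S ∩ F, (if e ∈ T then (1 : ℝ) else 0) = ∑ e ∈ S, w e := fun S => by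
    simp only [hw, Finset.sum_ite_mem]
    congr 1
    ext; simp; tauto
  have key := hD w hw0
  rw [tsum_fintype] at key
  simp only [hinter]
  have hmul : ∀ P : {P : Finset (Finset E) // IsPartitionDatum (fun T : Finset E => M.Indep ↑T) P},
      D P * ENNReal.ofReal (partitionWRank P.1 w)
        = ENNReal.ofReal ((D P).toReal * partitionWRank P.1 w) := fun P => by
    rw [ENNReal.ofReal_mul ENNReal.toReal_nonneg, ENNReal.ofReal_toReal (hne P)]
  have hnn : ∀ P : {P : Finset (Finset E) // IsPartitionDatum (fun T : Finset E => M.Indep ↑T) P},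
      0 ≤ (D P).toReal * partitionWRank P.1 w := fun P =>
    mul_nonneg ENNReal.toReal_nonneg (partitionWRank_nonneg _ hw0)
  simp only [hmul] at key
  rw [← ENNReal.ofReal_sum_of_nonneg fun P _ => hnn P,
    ENNReal.ofReal_le_ofReal_iff (Finset.sum_nonneg fun P _ => hnn P)] at key
  have hF : ∑ e ∈ F, (if e ∈ T then (1 : ℝ) else 0) = (T ∩ F).card := by
    rw [Finset.sum_ite_mem, Finset.inter_comm]
    simp
  calc α * ∑ e ∈ F, (if e ∈ T then (1 : ℝ) else 0)
      ≤ α * maxIndepWeight (fun T : Finset E => M.Indep ↑T) w := by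
        rw [hF]
        exact mul_le_mul_of_nonneg_left (card_le_maxIndepWeight_indicator M hT F) hα
    _ ≤ _ := key
    _ ≤ _ := Finset.sum_le_sum fun P _ => mul_le_mul_of_nonneg_left
        (partitionWRank_indicator_le P.2.1 _) ENNReal.toReal_nonneg

end PartitionProperty

section PairwiseIndependent

open ProbabilityTheory

/-- The probability of a union of pairwise independent events, bounded by the second
moment method. -/
theorem half_min_le_measureReal_biUnion {E Ω : Type*} [DecidableEq E] [MeasurableSpace Ω]
    (μ : Measure Ω) [IsProbabilityMeasure μ] (B : E → Set Ω)
    (hmeas : ∀ e, MeasurableSet (B e))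
    (hpw : ∀ e f, e ≠ f → μ.real (B e ∩ B f) = μ.real (B e) * μ.real (B f))
    (S : Finset E) :
    1 / 2 * min 1 (∑ e ∈ S, μ.real (B e)) ≤ μ.real (⋃ e ∈ S, B e) := by
  set m := ∑ e ∈ S, μ.real (B e) with hm
  have hm0 : 0 ≤ m := Finset.sum_nonneg fun e _ => measureReal_nonneg
  set U := ⋃ e ∈ S, B e with hU
  have hUm : MeasurableSet U := S.measurableSet_biUnion fun e _ => hmeas e
  have hi : ∀ V : Set Ω, MeasurableSet V → Integrable (V.indicator (1 : Ω → ℝ)) μ :=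
    fun V hV => (integrable_const 1).indicator hV
  set X : Ω → ℝ := fun ω => ∑ e ∈ S, (B e).indicator 1 ω with hX
  have hX2 : ∀ ω, X ω ^ 2 = ∑ e ∈ S, ∑ f ∈ S, (B e ∩ B f).indicator (1 : Ω → ℝ) ω := fun ω => by
    simp only [hX, sq, Finset.sum_mul_sum, Set.inter_indicator_one, Pi.mul_apply]
  have hXi : Integrable X μ := integrable_finsetSum _ fun e _ => hi _ (hmeas e)
  have hX2i : Integrable (fun ω => X ω ^ 2) μ := by
    simp only [hX2]
    exact integrable_finsetSum _ fun e _ => integrable_finsetSum _ fun f _ =>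
      hi _ ((hmeas e).inter (hmeas f))
  have hEX : ∫ ω, X ω ∂μ = m := by
    simp only [hX]
    rw [integral_finsetSum _ fun e _ => hi _ (hmeas e)]
    exact Finset.sum_congr rfl fun e _ => integral_indicator_one (hmeas e)
  have hEX2 : ∫ ω, X ω ^ 2 ∂μ ≤ m ^ 2 + m := by
    simp only [hX2]
    rw [integral_finsetSum _ fun e _ => integrable_finsetSum _ fun f _ =>
      hi _ ((hmeas e).inter (hmeas f)), sq, hm, Finset.sum_mul_sum, ← Finset.sum_add_distrib]
    refine Finset.sum_le_sum fun e he => ?_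
    rw [integral_finsetSum _ fun f _ => hi _ ((hmeas e).inter (hmeas f))]
    calc ∑ f ∈ S, ∫ ω, (B e ∩ B f).indicator (1 : Ω → ℝ) ω ∂μ
        ≤ ∑ f ∈ S, (μ.real (B e) * μ.real (B f) + if f = e then μ.real (B e) else 0) := by
          refine Finset.sum_le_sum fun f _ => ?_
          rw [integral_indicator_one ((hmeas e).inter (hmeas f))]
          split_ifs with hfe
          · subst hfe
            rw [Set.inter_self]
            exact le_add_of_nonneg_left (by positivity)
          · rw [hpw e f (Ne.symm hfe), add_zero]
      _ = _ := by rw [Finset.sum_add_distrib, Finset.sum_ite_eq' S e, if_pos he]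
  have hpt : ∀ a : ℝ, ∀ ω, 2 * a * X ω - a ^ 2 * X ω ^ 2 ≤ U.indicator (1 : Ω → ℝ) ω := by
    intro a ω
    by_cases hω : ω ∈ U
    · rw [Set.indicator_of_mem hω, Pi.one_apply]
      nlinarith [sq_nonneg (a * X ω - 1)]
    · have h0 : X ω = 0 := Finset.sum_eq_zero fun e he =>
        Set.indicator_of_notMem (fun h => hω (Set.mem_biUnion he h)) _
      simp [h0, hω]
  have hint : ∀ a : ℝ, 2 * a * m - a ^ 2 * (m ^ 2 + m) ≤ μ.real U := fun a => by
    have h := integral_mono ((hXi.const_mul (2 * a)).sub (hX2i.const_mul (a ^ 2))) (hi U hUm)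
      (hpt a)
    rw [integral_indicator_one hUm, integral_sub' (hXi.const_mul _) (hX2i.const_mul _),
      integral_const_mul, integral_const_mul, hEX] at h
    nlinarith [mul_le_mul_of_nonneg_left hEX2 (sq_nonneg a)]
  have h1 := hint (1 / (1 + m))
  refine le_trans ?_ h1
  have h2 : 2 * (1 / (1 + m)) * m - (1 / (1 + m)) ^ 2 * (m ^ 2 + m) = m / (1 + m) := by
    field_simp
    ring
  rw [h2, le_div_iff₀ (by positivity)]
  rcases le_total 1 m with h | h
  · rw [min_eq_left h]; linarith
  · rw [min_eq_right h]; nlinarith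

end PairwiseIndependent

/-- Let `M` be a finite matroid satisfying the `α`-partition property for some
`α ∈ (0,1]`. Then for every point `μ` of the matroid polytope, every random set `A`
with pairwise independent membership events and marginals `μ`, and every `F ⊆ E`:
`E[rank_M(A ∩ F)] ≥ (1/1.299)·(1 − 1/e)·α·∑_{e∈F} μ_e`. -/
theorem stmt16 {E : Type*} [Fintype E] [DecidableEq E]
    (M : Matroid E) (hME : M.E = Set.univ)
    (α : ℝ) (hα0 : 0 < α) (hα1 : α ≤ 1)
    (hpart : HasPartitionProperty (fun T : Finset E => M.Indep ↑T) α)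
    {Ω : Type*} [MeasurableSpace Ω] (μ : Measure Ω) [IsProbabilityMeasure μ]
    (marg : E → ℝ) (hmarg0 : ∀ e, 0 ≤ marg e) (hmarg1 : ∀ e, marg e ≤ 1)
    (hpoly : ∀ S : Finset E, ∑ e ∈ S, marg e ≤ (mrank M ↑S : ℝ))
    (A : Ω → Set E) (hmeas : ∀ e, MeasurableSet {ω | e ∈ A ω})
    (hAmarg : ∀ e, μ {ω | e ∈ A ω} = ENNReal.ofReal (marg e))
    (hpw : ∀ e f : E, e ≠ f →
      μ ({ω | e ∈ A ω} ∩ {ω | f ∈ A ω}) = μ {ω | e ∈ A ω} * μ {ω | f ∈ A ω})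
    (F : Finset E) :
    ENNReal.ofReal ((1 / 1.299) * (1 - 1 / Real.exp 1) * α * ∑ e ∈ F, marg e)
      ≤ ∫⁻ ω, (mrank M (A ω ∩ ↑F) : ℝ≥0∞) ∂μ := by
  classical
  obtain ⟨d, hd0, hd1, hd⟩ := hpart.exists_weights hME hα0.le
  rw [finsum_eq_sum_of_fintype] at hd1
  have hconv := hd marg hmarg0 hpoly F
  rw [finsum_eq_sum_of_fintype] at hconv
  set B : E → Set Ω := fun e => {ω | e ∈ A ω} with hB
  have hBreal : ∀ e, μ.real (B e) = marg e := fun e => by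
    rw [measureReal_def, hAmarg, ENNReal.toReal_ofReal (hmarg0 e)]
  have hpwr : ∀ e f, e ≠ f → μ.real (B e ∩ B f) = μ.real (B e) * μ.real (B f) :=
    fun e f hef => by
      simp only [measureReal_def]
      rw [hpw e f hef, ENNReal.toReal_mul]
  have hpart_le : ∀ P : {P : Finset (Finset E) //
      IsPartitionDatum (fun T : Finset E => M.Indep ↑T) P},
      ENNReal.ofReal (1 / 2 * ∑ p ∈ P.1, min 1 (∑ e ∈ p ∩ F, marg e))
        ≤ ∫⁻ ω, (mrank M (A ω ∩ ↑F) : ℝ≥0∞) ∂μ := by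
    intro P
    calc ENNReal.ofReal (1 / 2 * ∑ p ∈ P.1, min 1 (∑ e ∈ p ∩ F, marg e))
        ≤ ENNReal.ofReal (∑ p ∈ P.1, μ.real (⋃ e ∈ p ∩ F, B e)) := by
          refine ENNReal.ofReal_le_ofReal ?_
          rw [Finset.mul_sum]
          refine Finset.sum_le_sum fun p _ => ?_
          simpa only [hBreal] using half_min_le_measureReal_biUnion μ B hmeas hpwr (p ∩ F)
      _ = ∑ p ∈ P.1, μ (⋃ e ∈ p ∩ F, B e) := by
          rw [ENNReal.ofReal_sum_of_nonneg fun _ _ => measureReal_nonneg]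
          exact Finset.sum_congr rfl fun p _ => ofReal_measureReal (measure_ne_top _ _)
      _ = ∫⁻ ω, ∑ p ∈ P.1, (⋃ e ∈ p ∩ F, B e).indicator 1 ω ∂μ := by
          have hm : ∀ p : Finset E, MeasurableSet (⋃ e ∈ p ∩ F, B e) := fun p =>
            (p ∩ F).measurableSet_biUnion fun e _ => hmeas e
          rw [lintegral_finsetSum _ fun p _ => measurable_one.indicator (hm p)]
          exact Finset.sum_congr rfl fun p _ => (lintegral_indicator_one (hm p)).symm
      _ ≤ _ := by
          refine lintegral_mono fun ω => ?_
          have h := card_filter_inter_nonempty_le_mrank M P.2 (A ω ∩ ↑F)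
          refine le_trans (le_of_eq ?_) (Nat.cast_le.2 h)
          rw [Finset.card_filter, Nat.cast_sum]
          refine Finset.sum_congr rfl fun p _ => ?_
          simp only [Set.indicator_apply, Set.mem_iUnion, hB, Finset.mem_inter, Set.mem_inter_iff,
            Finset.mem_coe, Set.mem_ofPred_eq, Pi.one_apply, Nat.cast_ite, Nat.cast_one,
            Nat.cast_zero]
          refine if_congr ⟨?_, ?_⟩ rfl rfl
          · rintro ⟨e, ⟨hp, hF⟩, hA⟩
            exact ⟨e, hp, hA, hF⟩
          · rintro ⟨e, hp, hA, hF⟩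
            exact ⟨e, ⟨hp, hF⟩, hA⟩
  set R := ∫⁻ ω, (mrank M (A ω ∩ ↑F) : ℝ≥0∞) ∂μ
  have hconst : (1 / 1.299) * (1 - 1 / Real.exp 1) ≤ (1 / 2 : ℝ) := by
    have h1 : (1 : ℝ) / 2.7182818286 ≤ 1 / Real.exp 1 :=
      one_div_le_one_div_of_le (Real.exp_pos 1) Real.exp_one_lt_d9.le
    norm_num at h1 ⊢
    linarith
  have hsum0 : 0 ≤ α * ∑ e ∈ F, marg e :=
    mul_nonneg hα0.le (Finset.sum_nonneg fun e _ => hmarg0 e)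
  have hmin0 : ∀ P : {P : Finset (Finset E) //
      IsPartitionDatum (fun T : Finset E => M.Indep ↑T) P},
      0 ≤ 1 / 2 * ∑ p ∈ P.1, min 1 (∑ e ∈ p ∩ F, marg e) := fun P =>
    mul_nonneg (by norm_num) (Finset.sum_nonneg fun p _ =>
      le_min zero_le_one (Finset.sum_nonneg fun e _ => hmarg0 e))
  calc ENNReal.ofReal ((1 / 1.299) * (1 - 1 / Real.exp 1) * α * ∑ e ∈ F, marg e)
      ≤ ENNReal.ofReal (∑ P, d P * (1 / 2 * ∑ p ∈ P.1, min 1 (∑ e ∈ p ∩ F, marg e))) := by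
        refine ENNReal.ofReal_le_ofReal ?_
        simp only [mul_left_comm (d _) (1 / 2 : ℝ), ← Finset.mul_sum]
        rw [mul_assoc]
        exact mul_le_mul hconst (by simpa only [Finset.mul_sum] using hconv) hsum0 (by norm_num)
    _ = ∑ P, ENNReal.ofReal (d P)
          * ENNReal.ofReal (1 / 2 * ∑ p ∈ P.1, min 1 (∑ e ∈ p ∩ F, marg e)) := by
        rw [ENNReal.ofReal_sum_of_nonneg fun P _ => mul_nonneg (hd0 P) (hmin0 P)]
        exact Finset.sum_congr rfl fun P _ => ENNReal.ofReal_mul (hd0 P)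
    _ ≤ ∑ P, ENNReal.ofReal (d P) * R :=
        Finset.sum_le_sum fun P _ => mul_le_mul_right (hpart_le P) _
    _ = R := by
        rw [← Finset.sum_mul, ← ENNReal.ofReal_sum_of_nonneg fun P _ => hd0 P, hd1,
          ENNReal.ofReal_one, one_mul]
end

section
/- Let M = (E, I) be a finite matroid satisfying the α-partition property for some α ∈ (0, 1], and let m be a positive integer. Consider the m-fold parallel extension of M with ground set E × [m], in which a set S ⊆ E × [m] is independent if and only if the projection to E is injective on S and the projected image belongs to I. Then the m-fold parallel extension also satisfies the α-partition property: there is a probability distribution over families of pairwise disjoint nonempty subsets Q_1, …, Q_k of E × [m], each of whose transversals is independent in the extension, such that for every w: E × [m] → ℝ_{≥0}, E[Σ_i max_{x∈Q_i} w(x)] ≥ α · max{Σ_{x∈S} w(x) : S ⊆ E × [m] independent in the extension}. -/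
open scoped ENNReal

theorem PMF.tsum_map_mul_s17 {β γ : Type*} (D : PMF β) (f : β → γ) (g : γ → ℝ≥0∞) :
    ∑' c, D.map f c * g c = ∑' b, D b * g (f b) := by
  classical
  simp_rw [PMF.map_apply, ← ENNReal.tsum_mul_right]
  rw [ENNReal.tsum_comm]
  refine tsum_congr fun b => ?_
  rw [tsum_eq_single (f b)]
  · simp
  · intro c hc
    simp [hc]

/-- The family of parts `p × ι`, for `p` in the family `P`. -/
def liftParts {γ : Type*} [DecidableEq γ] (ι : Type*) [Fintype ι] [DecidableEq ι]
    (P : Finset (Finset γ)) : Finset (Finset (γ × ι)) :=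
  P.image fun p => p ×ˢ Finset.univ

theorem isPartitionDatum_liftParts {γ ι : Type*} [DecidableEq γ] [Fintype ι] [DecidableEq ι]
    [Nonempty ι] {I : Set γ → Prop} {P : Finset (Finset γ)}
    (hP : IsPartitionDatum (fun T : Finset γ => I T) P) :
    IsPartitionDatum (fun S : Finset (γ × ι) =>
      Set.InjOn Prod.fst (S : Set (γ × ι)) ∧ I (Prod.fst '' (S : Set (γ × ι))))
      (liftParts ι P) := by
  obtain ⟨hne, hdisj, htrans⟩ := hP
  simp only [IsPartitionDatum, liftParts, Finset.forall_mem_image, Finset.exists_mem_image,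
    Finset.mem_product, Finset.mem_univ, and_true]
  refine ⟨fun p hp => (hne p hp).product Finset.univ_nonempty, fun p hp q hq hpq => ?_,
    fun T hT hcard => ?_⟩
  · exact Finset.disjoint_product.2 (Or.inl (hdisj p hp q hq fun h => hpq (by rw [h])))
  · have heq : ∀ p ∈ P, ∀ x ∈ T, ∀ y ∈ T, x.1 ∈ p → y.1 ∈ p → x = y := by
      intro p hp x hx y hy hxp hyp
      exact Finset.card_le_one.1 (hcard hp) x (by simp [hx, hxp]) y (by simp [hy, hyp])
    refine ⟨fun x hx y hy hxy => ?_, ?_⟩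
    · obtain ⟨p, hp, hxp⟩ := hT x hx
      exact heq p hp x hx y hy hxp (hxy ▸ hxp)
    · rw [← Finset.coe_image]
      refine htrans _ ?_ fun p hp => Finset.card_le_one.2 ?_
      · simpa only [Finset.forall_mem_image] using hT
      · simp only [Finset.mem_inter, Finset.mem_image]
        rintro _ ⟨⟨x, hx, rfl⟩, hxp⟩ _ ⟨⟨y, hy, rfl⟩, hyp⟩
        rw [heq p hp x hx y hy hxp hyp]

theorem partitionWRank_iSup_le {γ ι : Type*} [DecidableEq γ] [Fintype ι] [DecidableEq ι]
    [Nonempty ι] {P : Finset (Finset γ)} (hP : ∀ p ∈ P, p.Nonempty) (w : γ × ι → ℝ) :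
    partitionWRank P (fun e => ⨆ j, w (e, j)) ≤ partitionWRank (liftParts ι P) w := by
  unfold partitionWRank liftParts
  rw [Finset.sum_image]
  · refine Finset.sum_le_sum fun p hp => csSup_le ((hP p hp).to_set.image _) ?_
    rintro _ ⟨e, he, rfl⟩
    refine ciSup_le fun j => le_csSup (Set.Finite.bddAbove ?_) ⟨(e, j), ?_, rfl⟩
    · exact (Finset.finite_toSet _).image _
    · simpa using he
  · intro p _ q _ hpq
    ext e
    obtain ⟨j⟩ := ‹Nonempty ι›
    simpa using Finset.ext_iff.1 hpq (e, j)

theorem maxIndepWeight_le_iSup {γ ι : Type*} [Fintype γ] [Finite ι] {I : Set γ → Prop}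
    (hI : I ∅) (w : γ × ι → ℝ) :
    maxIndepWeight (fun S : Finset (γ × ι) =>
      Set.InjOn Prod.fst (S : Set (γ × ι)) ∧ I (Prod.fst '' (S : Set (γ × ι)))) w ≤
      maxIndepWeight (fun T : Finset γ => I T) (fun e => ⨆ j, w (e, j)) := by
  classical
  refine csSup_le ⟨0, ∅, by simpa using hI, by simp⟩ ?_
  rintro _ ⟨S, ⟨hinj, hS⟩, rfl⟩
  calc ∑ x ∈ S, w x ≤ ∑ x ∈ S, ⨆ j, w (x.1, j) :=
        Finset.sum_le_sum fun x _ =>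
          le_ciSup (f := fun j => w (x.1, j)) (Set.finite_range _).bddAbove x.2
    _ = ∑ e ∈ S.image Prod.fst, ⨆ j, w (e, j) := (Finset.sum_image (f := fun e => ⨆ j, w (e, j)) hinj).symm
    _ ≤ _ := by
      refine le_csSup (Set.Finite.bddAbove ?_) ⟨S.image Prod.fst, by simpa using hS, rfl⟩
      refine (Set.finite_range fun T : Finset γ => ∑ e ∈ T, ⨆ j, w (e, j)).subset ?_
      rintro _ ⟨T, -, rfl⟩
      exact ⟨T, rfl⟩

/-- If a finite matroid `M` satisfies the `α`-partition property, then so does its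
`m`-fold parallel extension on `E × [m]`, in which a set is independent iff the
projection to `E` is injective on it and the projected image is independent in `M`. -/
theorem stmt17 {E : Type*} [Fintype E] [DecidableEq E]
    (M : Matroid E) (hME : M.E = Set.univ)
    (α : ℝ) (hα0 : 0 < α) (hα1 : α ≤ 1)
    (m : ℕ) (hm : 0 < m)
    (hpart : HasPartitionProperty (fun T : Finset E => M.Indep ↑T) α) :
    HasPartitionProperty
      (fun S : Finset (E × Fin m) =>
        Set.InjOn Prod.fst (S : Set (E × Fin m)) ∧
          M.Indep (Prod.fst '' (S : Set (E × Fin m)))) α := by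
  have : Nonempty (Fin m) := ⟨⟨0, hm⟩⟩
  obtain ⟨D, hD⟩ := hpart
  refine ⟨D.map fun P => ⟨liftParts (Fin m) P.1, isPartitionDatum_liftParts P.2⟩,
    fun w hw => ?_⟩
  rw [PMF.tsum_map_mul_s17]
  calc _ ≤ ENNReal.ofReal (α * maxIndepWeight (fun T : Finset E => M.Indep ↑T)
          (fun e => ⨆ j, w (e, j))) :=
        ENNReal.ofReal_le_ofReal
          (mul_le_mul_of_nonneg_left (maxIndepWeight_le_iSup M.empty_indep w) hα0.le)
    _ ≤ _ := hD _ fun e => Real.iSup_nonneg fun j => hw (e, j)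
    _ ≤ _ := by
      gcongr with P
      exact partitionWRank_iSup_le P.2.1 w
end
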